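/- arXiv:0906.2948 — 13 statements merged into one kernel-verified Lean document; each statement's English description precedes it below -/
import Mathlib

section
/- Let q be an odd prime power with q ≡ 2 (mod 3), let K be a finite field with exactly q² elements, let m = (q+1)/3, and let w ∈ K satisfy w^m = 3. Then the number of triples (x, y, z) ∈ K × K × K satisfying x^m + y^m + 1 = 0 and z³ = w·x·y equals q² + 1 + q(q² − q + 4)/3 − (q+1)/3 (equivalently, (q³ + 2q² + 3q + 2)/3). (This is the point-count form of the statement that the function field K(x,y,z) with x^m + y^m + 1 = 0 and z³ = wxy is an F_{q²}-maximal function field of genus (q² − q + 4)/6.) -/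
open Finset in
theorem card_filter_pow_eq_of_mul_eq {K : Type*} [Field K] [Fintype K] [DecidableEq K] {n k : ℕ}
    (hn : 0 < n) (hnk : n * k = Fintype.card K - 1) {t : K} (ht : t ≠ 0) :
    #{x : K | x ^ n = t} = if t ^ k = 1 then n else 0 := by
  have hk : 0 < k := by
    have := Fintype.one_lt_card (α := K)
    exact Nat.pos_of_ne_zero (by rintro rfl; omega)
  obtain ⟨g, hg⟩ := IsCyclic.exists_generator (α := Kˣ)
  have hord : orderOf g = n * k := by
    rw [orderOf_eq_card_of_forall_mem_zpowers hg, Nat.card_eq_fintype_card, Fintype.card_units, hnk]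
  have hprim : IsPrimitiveRoot ((g : K) ^ k) n :=
    (IsPrimitiveRoot.coe_units_iff.mpr (IsPrimitiveRoot.orderOf g)).pow
      (by rw [hord]; positivity) (by rw [hord, mul_comm])
  have key : #{x : K | x ^ n = t} = Multiset.card (Polynomial.nthRoots n t) := by
    rw [← Multiset.toFinset_card_of_nodup (hprim.nthRoots_nodup ht)]
    congr 1
    ext x
    simp [Polynomial.mem_nthRoots hn]
  suffices hiff : (∃ a, a ^ n = t) ↔ t ^ k = 1 by
    simp only [key, hprim.card_nthRoots t, hiff]
  refine ⟨?_, fun h => ?_⟩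
  · rintro ⟨a, rfl⟩
    have ha : a ≠ 0 := by rintro rfl; simp [hn.ne'] at ht
    rw [← pow_mul, hnk, FiniteField.pow_card_sub_one_eq_one a ha]
  · obtain ⟨j, hj⟩ := (mem_powers_iff_mem_zpowers).mpr (hg (Units.mk0 t ht))
    have hj' : g ^ j = Units.mk0 t ht := hj
    have h1 : g ^ (j * k) = 1 := by
      rw [pow_mul, hj']
      exact Units.ext (by simpa using h)
    have h2 := orderOf_dvd_of_pow_eq_one h1
    rw [hord] at h2
    obtain ⟨i, rfl⟩ := Nat.dvd_of_mul_dvd_mul_right hk h2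
    refine ⟨(g : K) ^ i, ?_⟩
    have := congrArg (Units.val) hj'
    simp only [Units.val_pow_eq_pow_val, Units.val_mk0] at this
    rw [← pow_mul, mul_comm i n, this]

theorem exists_ringHom_pow_of_card_eq_sq {K : Type*} [Field K] [Fintype K] {q : ℕ}
    (hK : Fintype.card K = q ^ 2) : ∃ φ : K →+* K, ∀ x, φ x = x ^ q := by
  obtain ⟨p, hp, k, hprime, hk⟩ := FiniteField.card' K
  have : Fact p.Prime := ⟨hprime⟩
  obtain ⟨i, -, rfl⟩ := (Nat.dvd_prime_pow hprime).mp
    (show q ∣ p ^ (k : ℕ) by rw [← hk, hK]; exact dvd_pow_self q two_ne_zero)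
  exact ⟨iterateFrobenius K p i, fun x => iterateFrobenius_def p i x⟩

theorem pow_sub_one_eq_one_iff_pow_eq_self {K : Type*} [Field K] {q : ℕ} (hq : 0 < q)
    {t : K} (ht : t ≠ 0) : t ^ (q - 1) = 1 ↔ t ^ q = t := by
  obtain ⟨r, rfl⟩ := Nat.exists_eq_add_of_lt hq
  simp [pow_succ, ht]

theorem three_ne_zero_of_card_eq_sq {K : Type*} [Field K] [Fintype K] {q : ℕ}
    (hq3 : q % 3 = 2) (hK : Fintype.card K = q ^ 2) : (3 : K) ≠ 0 := by
  intro h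
  have hcast : ((Fintype.card K : ℕ) : K) = 0 := FiniteField.cast_card_eq_zero K
  have hmod : q ^ 2 = 3 * (q ^ 2 / 3) + 1 := by
    have : q ^ 2 % 3 = 1 := by rw [Nat.pow_mod, hq3]
    omega
  rw [hK, hmod] at hcast
  push_cast at hcast
  simp [h] at hcast

open Finset in
theorem card_filter_pow_mul_pow_eq_one {K : Type*} [Field K] [Fintype K] [DecidableEq K]
    {q : ℕ} (hodd : Odd q) (hq3 : q % 3 = 2) (hK : Fintype.card K = q ^ 2) :
    #{a : K | a ≠ 0 ∧ a + 1 ≠ 0 ∧ a ^ (3 * (q - 1)) = 1 ∧ (-1 - a) ^ (3 * (q - 1)) = 1 ∧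
      (a * (-1 - a)) ^ (q - 1) = 1} = q := by
  obtain ⟨φ, hφ⟩ := exists_ringHom_pow_of_card_eq_sq hK
  have h3 : (3 : K) ≠ 0 := three_ne_zero_of_card_eq_sq hq3 hK
  have hq0 : 0 < q := hodd.pos
  have hq1 : 1 < q := by rcases hodd with ⟨r, rfl⟩; omega
  have hpow : ∀ t : K, t ≠ 0 → (t ^ (q - 1) = 1 ↔ φ t = t) := fun t ht => by
    rw [pow_sub_one_eq_one_iff_pow_eq_self hq0 ht, hφ]
  have hpow3 : ∀ t : K, t ≠ 0 → (t ^ (3 * (q - 1)) = 1 ↔ φ t ^ 3 = t ^ 3) := fun t ht => by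
    rw [pow_mul, hpow _ (pow_ne_zero 3 ht), map_pow]
  have hsplit : ({a : K | a ≠ 0 ∧ a + 1 ≠ 0 ∧ a ^ (3 * (q - 1)) = 1 ∧
      (-1 - a) ^ (3 * (q - 1)) = 1 ∧ (a * (-1 - a)) ^ (q - 1) = 1} : Finset K) =
      ({a : K | a ^ (q - 1) = 1} : Finset K).erase (-1) ∪
        ({a : K | a ^ 3 = 1} : Finset K).erase 1 := by
    ext a
    simp only [mem_filter, mem_univ, true_and, mem_union, mem_erase]
    constructor
    · rintro ⟨ha, ha1, e1, -, e3⟩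
      have hb : -1 - a ≠ 0 := fun h => ha1 (by linear_combination -h)
      rw [hpow3 a ha] at e1
      rw [hpow _ (mul_ne_zero ha hb), map_mul, map_sub, map_neg, map_one] at e3
      have hfac : (φ a - a) * (φ a + a + 1) = 0 := by linear_combination -e3
      rcases mul_eq_zero.mp hfac with h | h
      · exact .inl ⟨fun h' => ha1 (by rw [h']; ring), (hpow a ha).mpr (sub_eq_zero.mp h)⟩
      · have hφa : φ a = -1 - a := by linear_combination h
        have hfac' : (2 * a + 1) * (a ^ 2 + a + 1) = 0 := by
          rw [hφa] at e1
          linear_combination -e1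
        rcases mul_eq_zero.mp hfac' with h' | h'
        · refine .inl ⟨fun h' => ha1 (by rw [h']; ring), (hpow a ha).mpr ?_⟩
          rw [hφa]
          linear_combination -h'
        · refine .inr ⟨fun h1 => h3 ?_, ?_⟩
          · rw [h1] at h'
            linear_combination h'
          · linear_combination (a - 1) * h'
    · rintro (⟨hne, h⟩ | ⟨hne, h⟩)
      · have ha : a ≠ 0 := by
          rintro rfl
          rw [zero_pow (by omega)] at h
          exact zero_ne_one h
        have ha1 : a + 1 ≠ 0 := fun h' => hne (by linear_combination h')
        have hb : -1 - a ≠ 0 := fun h => ha1 (by linear_combination -h)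
        have hb' : (-1 - a) ^ (q - 1) = 1 := by
          rw [hpow _ hb, map_sub, map_neg, map_one, (hpow a ha).mp h]
        refine ⟨ha, ha1, ?_, ?_, ?_⟩
        · rw [mul_comm, pow_mul, h, one_pow]
        · rw [mul_comm, pow_mul, hb', one_pow]
        · rw [mul_pow, h, hb', one_mul]
      · have ha : a ≠ 0 := by rintro rfl; simp at h
        have hquad : a ^ 2 + a + 1 = 0 := by
          refine (mul_eq_zero.mp (?_ : (a - 1) * (a ^ 2 + a + 1) = 0)).resolve_left
            (sub_ne_zero.mpr hne)
          linear_combination h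
        have hb : -1 - a = a ^ 2 := by linear_combination -hquad
        refine ⟨ha, fun h' => ha ?_, ?_, ?_, ?_⟩
        · exact pow_eq_zero_iff two_ne_zero |>.mp (by linear_combination hquad - h')
        · rw [pow_mul, h, one_pow]
        · rw [hb, ← pow_mul, mul_left_comm, pow_mul, h, one_pow]
        · rw [hb, ← pow_succ', h, one_pow]
  have hdisj : Disjoint (({a : K | a ^ (q - 1) = 1} : Finset K).erase (-1))
      (({a : K | a ^ 3 = 1} : Finset K).erase 1) := by
    rw [Finset.disjoint_left]
    intro a ha ha'
    simp only [mem_filter, mem_univ, true_and, mem_erase] at ha ha'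
    apply ha'.1
    have hq3' : q - 1 = 3 * ((q - 1) / 3) + 1 := by omega
    have h := ha.2
    rwa [hq3', pow_succ, pow_mul, ha'.2, one_pow, one_mul] at h
  have hcard : q ^ 2 - 1 = (q + 1) * (q - 1) := by simpa using Nat.sq_sub_sq q 1
  have hc1 : #{a : K | a ^ (q - 1) = 1} = q - 1 := by
    rw [card_filter_pow_eq_of_mul_eq (k := q + 1) (by omega) (by rw [hK, hcard, mul_comm])
      one_ne_zero, if_pos (one_pow _)]
  have hc3 : #{a : K | a ^ 3 = 1} = 3 := by
    rw [card_filter_pow_eq_of_mul_eq (k := (q + 1) / 3 * (q - 1)) (by omega)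
      (by rw [hK, hcard, ← mul_assoc, Nat.mul_div_cancel' (by omega)])
      one_ne_zero, if_pos (one_pow _)]
  rw [hsplit, card_union_of_disjoint hdisj, card_erase_of_mem, card_erase_of_mem, hc1, hc3]
  · omega
  · simp
  · have : Even (q - 1) := by rcases hodd with ⟨r, rfl⟩; simp
    simp [this.neg_one_pow]

open Finset in
theorem card_affine_points_eq {K : Type*} [Field K] [Fintype K] [DecidableEq K]
    {q : ℕ} (hodd : Odd q) (hq3 : q % 3 = 2) (hK : Fintype.card K = q ^ 2)
    {m : ℕ} (hm : q + 1 = 3 * m) {w : K} (hw : w ^ m = 3) :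
    #{p : K × K × K | p.1 ^ m + p.2.1 ^ m + 1 = 0 ∧ p.2.2 ^ 3 = w * p.1 * p.2.1} =
      2 * m + 3 * m ^ 2 * q := by
  obtain ⟨φ, hφ⟩ := exists_ringHom_pow_of_card_eq_sq hK
  have h3 : (3 : K) ≠ 0 := three_ne_zero_of_card_eq_sq hq3 hK
  have hm0 : 0 < m := by omega
  have hq0 : 0 < q := hodd.pos
  have hcard : q ^ 2 - 1 = (q + 1) * (q - 1) := by simpa using Nat.sq_sub_sq q 1
  have h3pow : (3 : K) ^ (q - 1) = 1 := by
    rw [pow_sub_one_eq_one_iff_pow_eq_self hq0 h3, ← hφ, map_ofNat]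
  have hw0 : w ≠ 0 := by
    rintro rfl
    rw [zero_pow hm0.ne'] at hw
    exact h3 hw.symm
  let r : K → ℕ := fun a => #{x : K | x ^ m = a}
  let d : K → ℕ := fun a => if a * (-1 - a) = 0 then 1 else
    if (a * (-1 - a)) ^ (q - 1) = 1 then 3 else 0
  have hr0 : r 0 = 1 := by simp [r, hm0.ne', filter_eq']
  have hr : ∀ t ≠ 0, r t = if t ^ (3 * (q - 1)) = 1 then m else 0 := fun t ht =>
    card_filter_pow_eq_of_mul_eq hm0 (by rw [hK, hcard, hm]; ring) ht
  have hrneg : r (-1) = m := by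
    rw [hr _ (by simp), if_pos]
    have : Even (q - 1) := by rcases hodd with ⟨r, rfl⟩; simp
    simp [(this.mul_left 3).neg_one_pow]
  have hd : ∀ x y : K, x ^ m + y ^ m + 1 = 0 → #{z : K | z ^ 3 = w * x * y} = d (x ^ m) := by
    intro x y hxy
    have hy : -1 - x ^ m = y ^ m := by linear_combination -hxy
    simp only [d, hy]
    by_cases hxy0 : x * y = 0
    · rw [if_pos (by rw [← mul_pow, hxy0, zero_pow hm0.ne']), mul_assoc, hxy0]
      simp [filter_eq']
    · rw [if_neg (by rw [← mul_pow]; exact pow_ne_zero m hxy0),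
        card_filter_pow_eq_of_mul_eq (k := m * (q - 1)) (by norm_num)
          (by rw [hK, hcard, hm]; ring) (by rw [mul_assoc]; exact mul_ne_zero hw0 hxy0)]
      rw [pow_mul, mul_assoc, mul_pow, mul_pow x, hw, mul_pow, h3pow, one_mul]
  have hsum : #{p : K × K × K | p.1 ^ m + p.2.1 ^ m + 1 = 0 ∧ p.2.2 ^ 3 = w * p.1 * p.2.1} =
      ∑ a, r a * (r (-1 - a) * d a) := by
    calc _ = ∑ x : K, ∑ y : K, if x ^ m + y ^ m + 1 = 0 then d (x ^ m) else 0 := by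
          rw [card_filter, Fintype.sum_prod_type]
          refine sum_congr rfl fun x _ => ?_
          rw [Fintype.sum_prod_type]
          refine sum_congr rfl fun y _ => ?_
          split_ifs with h
          · rw [← hd x y h, card_filter]
            simp [h]
          · simp [h]
      _ = ∑ x : K, r (-1 - x ^ m) * d (x ^ m) := by
          refine sum_congr rfl fun x _ => ?_
          rw [← sum_filter, sum_const, smul_eq_mul]
          congr 2
          ext y
          simp only [mem_filter, mem_univ, true_and]
          exact ⟨fun h => by linear_combination h, fun h => by linear_combination h⟩
      _ = _ := by
          rw [← sum_fiberwise univ (fun x : K => x ^ m)]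
          refine sum_congr rfl fun a _ => ?_
          rw [sum_congr rfl (g := fun _ => r (-1 - a) * d a), sum_const, smul_eq_mul]
          intro x hx
          rw [(mem_filter.mp hx).2]
  have hterm : ∀ a : K, r a * (r (-1 - a) * d a) = (if a = 0 then m else 0) +
      (if a = -1 then m else 0) + if a ≠ 0 ∧ a + 1 ≠ 0 ∧ a ^ (3 * (q - 1)) = 1 ∧
        (-1 - a) ^ (3 * (q - 1)) = 1 ∧ (a * (-1 - a)) ^ (q - 1) = 1 then 3 * m ^ 2 else 0 := by
    intro a
    by_cases ha : a = 0
    · subst ha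
      simp [hr0, hrneg, d]
    by_cases ha1 : a = -1
    · subst ha1
      simp [hr0, hrneg, d]
    have hb : -1 - a ≠ 0 := fun h => ha1 (by linear_combination -h)
    have ha1' : a + 1 ≠ 0 := fun h => ha1 (by linear_combination h)
    simp only [hr a ha, hr _ hb, d, if_neg (mul_ne_zero ha hb), ne_eq, ha, ha1, ha1', if_false,
      not_false_eq_true, true_and, zero_add, ite_and]
    split_ifs <;> ring
  rw [hsum, sum_congr rfl fun a _ => hterm a, sum_add_distrib, sum_add_distrib,
    sum_ite_eq' univ (0 : K), sum_ite_eq' univ (-1 : K), ← sum_filter, sum_const,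
    card_filter_pow_mul_pow_eq_one hodd hq3 hK]
  simp only [mem_univ, if_true, smul_eq_mul]
  ring

/-- Point-count form of the maximality of the function field `K(x,y,z)` with
`x^m + y^m + 1 = 0` and `z^3 = w·x·y`, where `m = (q+1)/3` and `w^m = 3`,
over a finite field `K` with `q^2` elements, `q` an odd prime power with
`q ≡ 2 (mod 3)`. -/
theorem stmt_0 (q : ℕ) (hq : IsPrimePow q) (hodd : Odd q) (hq3 : q % 3 = 2)
    (K : Type*) [Field K] [Fintype K] (hK : Fintype.card K = q ^ 2)
    (m : ℕ) (hm : m = (q + 1) / 3) (w : K) (hw : w ^ m = 3) :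
    Nat.card {p : K × K × K // p.1 ^ m + p.2.1 ^ m + 1 = 0 ∧
        p.2.2 ^ 3 = w * p.1 * p.2.1} =
      q ^ 2 + 1 + q * (q ^ 2 - q + 4) / 3 - (q + 1) / 3 := by
  classical
  have hm' : q + 1 = 3 * m := by omega
  rw [Nat.card_eq_fintype_card, Fintype.card_subtype, card_affine_points_eq hodd hq3 hK hm' hw]
  have hm0 : 0 < m := by omega
  obtain ⟨n, rfl⟩ : ∃ n, m = n + 1 := ⟨m - 1, by omega⟩
  obtain rfl : q = 3 * n + 2 := by omega
  have h1 : (3 * n + 2) ^ 2 - (3 * n + 2) + 4 = 3 * (3 * n ^ 2 + 3 * n + 2) := by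
    have : (3 * n + 2) ^ 2 = 3 * (3 * n ^ 2 + 3 * n) + 2 + (3 * n + 2) - 0 := by
      rw [Nat.sub_zero]
      ring
    omega
  rw [← hm, h1, mul_left_comm, Nat.mul_div_cancel_left _ (by norm_num)]
  refine (Nat.sub_eq_of_eq_add ?_).symm
  ring
end

section
/- Let K be a finite field with exactly 49 elements. Then the number of pairs (t, z) ∈ K × K satisfying z^16 = t·(t+1)^6 equals 146. (This is the point-count form of the statement that the function field K(t,z) with z^16 = t(t+1)^6 is an F_49-maximal function field of genus 7, whose set of places of degree one has 148 elements.) -/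
open scoped QuadraticAlgebra

/-- The ring `F_7[i]` with `i ^ 2 = -1`. -/
abbrev GaussSeven : Type := QuadraticAlgebra (ZMod 7) (-1) 0

instance : Fintype GaussSeven := Fintype.ofEquiv _ (QuadraticAlgebra.equivProd (-1) 0).symm

instance : Fact (∀ r : ZMod 7, r ^ 2 ≠ -1 + 0 * r) := ⟨by decide⟩

/-- A field with 49 elements is isomorphic to `F_7[i]`. -/
theorem nonempty_gaussSeven_ringEquiv (K : Type*) [Field K] [Fintype K]
    (hK : Fintype.card K = 49) : Nonempty (GaussSeven ≃+* K) := by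
  have : Fact (Nat.Prime 7) := ⟨by norm_num⟩
  have : CharP K 7 := charP_of_card_eq_prime_pow (f := 2) (by simp [hK])
  let : Algebra (ZMod 7) K := ZMod.algebra K 7
  obtain ⟨u, hu⟩ : IsSquare (-1 : K) := by
    rw [FiniteField.isSquare_neg_one_iff, hK]
    decide
  let f : GaussSeven →ₐ[ZMod 7] K := QuadraticAlgebra.lift ⟨u, by simp [← hu]⟩
  refine ⟨RingEquiv.ofBijective f ((Fintype.bijective_iff_injective_and_card f).2
    ⟨f.toRingHom.injective, ?_⟩)⟩
  rw [hK]
  exact (Fintype.card_congr (QuadraticAlgebra.equivProd (-1) 0)).trans (by simp)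

theorem gaussSeven_pow_sixteen (z : GaussSeven) :
    z ^ 16 = ⟨QuadraticAlgebra.norm z ^ 2, 0⟩ := by
  revert z
  decide +kernel

theorem card_gaussSeven_pow_sixteen_eq (w : GaussSeven) :
    Fintype.card {z : GaussSeven // z ^ 16 = w} =
      if w.im = 0 then if w.re = 0 then 1 else if w.re ^ 3 = 1 then 16 else 0 else 0 := by
  have card_norm_sq (c : ZMod 7) :
      Fintype.card {z : GaussSeven // QuadraticAlgebra.norm z ^ 2 = c} =
        if c = 0 then 1 else if c ^ 3 = 1 then 16 else 0 := by
    revert c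
    decide +kernel
  simp_rw [gaussSeven_pow_sixteen, QuadraticAlgebra.ext_iff]
  by_cases h : w.im = 0
  · simp [h, card_norm_sq]
  · simp [h, Ne.symm h]

theorem card_gaussSeven_curve :
    Fintype.card {p : GaussSeven × GaussSeven // p.2 ^ 16 = p.1 * (p.1 + 1) ^ 6} = 146 := by
  rw [Fintype.card_congr (Equiv.subtypeProdEquivSigmaSubtype
    fun t z : GaussSeven => z ^ 16 = t * (t + 1) ^ 6), Fintype.card_sigma]
  simp_rw [card_gaussSeven_pow_sixteen_eq]
  decide +kernel

/-- Point-count form of the maximality of the function field `F_49(t,z)` with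
`z^16 = t(t+1)^6`. -/
theorem stmt_1 (K : Type*) [Field K] [Fintype K] (hK : Fintype.card K = 49) :
    Nat.card {p : K × K // p.2 ^ 16 = p.1 * (p.1 + 1) ^ 6} = 146 := by
  obtain ⟨e⟩ := nonempty_gaussSeven_ringEquiv K hK
  rw [← card_gaussSeven_curve, ← Nat.card_eq_fintype_card]
  refine (Nat.card_congr ((Equiv.prodCongr e.toEquiv e.toEquiv).subtypeEquiv fun p => ?_)).symm
  rw [← e.injective.eq_iff]
  simp
end

section
/- Let q be a prime power with q ≡ 2 (mod 3), let K be a finite field with exactly q² elements, and let m = (q+1)/3. Then the number of pairs (x, y) ∈ K × K satisfying x^m + y^m + 1 = 0 equals q² + 1 + q(m−1)(m−2) − m. (This is the point-count form of the F_{q²}-maximality of the Fermat-type function field K(x,y) with y^m + x^m + 1 = 0, which has genus (m−1)(m−2)/2 and m places at infinity.) -/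
/-- A finite field contains a primitive `d`-th root of unity for every `d` dividing the order
of its unit group. -/
theorem FiniteField.exists_isPrimitiveRoot_of_dvd {K : Type*} [Field K] [Fintype K] {d : ℕ}
    (hd : d ∣ Fintype.card K - 1) : ∃ ζ : K, IsPrimitiveRoot ζ d := by
  obtain ⟨g, hg⟩ := IsCyclic.exists_ofOrder_eq_natCard (α := Kˣ)
  have hpos : 0 < Fintype.card K - 1 := Nat.sub_pos_of_lt Fintype.one_lt_card
  have hprim : IsPrimitiveRoot (g : K) (Fintype.card K - 1) := by
    rw [IsPrimitiveRoot.coe_units_iff]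
    have := IsPrimitiveRoot.orderOf g
    rwa [hg, Nat.card_units, Nat.card_eq_fintype_card] at this
  obtain ⟨e, he⟩ := hd
  exact ⟨_, hprim.pow hpos (by rw [he, mul_comm])⟩

/-- Power residue criterion: if `m * e` is the order of the unit group, the nonzero `m`-th powers
are the roots of `X ^ e - 1`. -/
theorem FiniteField.exists_pow_eq_iff {K : Type*} [Field K] [Fintype K] {m e : ℕ}
    (h : Fintype.card K - 1 = m * e) {a : K} (ha : a ≠ 0) :
    (∃ x : K, x ^ m = a) ↔ a ^ e = 1 := by
  have hpos : 0 < Fintype.card K - 1 := Nat.sub_pos_of_lt Fintype.one_lt_card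
  have hm : m ≠ 0 := by rintro rfl; omega
  have he : 0 < e := Nat.pos_of_ne_zero (by rintro rfl; omega)
  constructor
  · rintro ⟨x, rfl⟩
    rw [← pow_mul, ← h]
    exact FiniteField.pow_card_sub_one_eq_one x (by rintro rfl; exact ha (zero_pow hm))
  · intro hae
    obtain ⟨ζ, hζ⟩ := FiniteField.exists_isPrimitiveRoot_of_dvd (K := K) dvd_rfl
    have : NeZero (Fintype.card K - 1) := ⟨hpos.ne'⟩
    obtain ⟨k, -, rfl⟩ := hζ.eq_pow_of_pow_eq_one (FiniteField.pow_card_sub_one_eq_one a ha)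
    rw [← pow_mul, hζ.pow_eq_one_iff_dvd, h] at hae
    obtain ⟨j, rfl⟩ := Nat.dvd_of_mul_dvd_mul_right he hae
    exact ⟨ζ ^ j, by rw [← pow_mul, mul_comm]⟩

/-- The number of `m`-th roots of a nonzero element of a finite field whose unit group has
order `m * e`. -/
theorem FiniteField.card_filter_pow_eq {K : Type*} [Field K] [Fintype K] [DecidableEq K] {m e : ℕ}
    (h : Fintype.card K - 1 = m * e) {a : K} (ha : a ≠ 0) :
    (Finset.univ.filter fun x : K => x ^ m = a).card = if a ^ e = 1 then m else 0 := by
  have hpos : 0 < Fintype.card K - 1 := Nat.sub_pos_of_lt Fintype.one_lt_card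
  have hm : 0 < m := Nat.pos_of_ne_zero (by rintro rfl; omega)
  obtain ⟨ζ, hζ⟩ := FiniteField.exists_isPrimitiveRoot_of_dvd (K := K) (Dvd.intro _ h.symm)
  have hset : (Finset.univ.filter fun x : K => x ^ m = a) =
      (Polynomial.nthRoots m a).toFinset := by
    ext x
    simp [Polynomial.mem_nthRoots hm]
  rw [hset, Multiset.toFinset_card_of_nodup (hζ.nthRoots_nodup ha), hζ.card_nthRoots]
  simp only [FiniteField.exists_pow_eq_iff h ha]

/-- In a finite field with `q ^ 2` elements the `q`-th power map is additive. -/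
theorem FiniteField.add_pow_of_card_eq_sq {K : Type*} [Field K] [Fintype K] {q : ℕ}
    (hq : IsPrimePow q) (hK : Fintype.card K = q ^ 2) (x y : K) :
    (x + y) ^ q = x ^ q + y ^ q := by
  obtain ⟨p, k, hp, hk, rfl⟩ := hq
  have hp' : p.Prime := hp.nat_prime
  obtain ⟨r, hr⟩ := CharP.exists K
  obtain ⟨n, hrp, hn⟩ := FiniteField.card K r
  have : p = r := by
    rw [hK] at hn
    have h1 : p ∣ r ^ (n : ℕ) := hn ▸ dvd_pow (dvd_pow_self p hk.ne') two_ne_zero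
    exact (Nat.prime_dvd_prime_iff_eq hp' hrp).1 (hp'.dvd_of_dvd_pow h1)
  subst this
  have : Fact p.Prime := ⟨hp'⟩
  exact add_pow_char_pow x y p k

/-- In a field with `q ^ 2` elements, `q ≡ 2 (mod 3)`, there are exactly `q` ways to write `-1` as
an ordered sum of two roots of `X ^ (3 * (q - 1)) - 1`. -/
theorem FiniteField.card_filter_pow_three_mul_sub_one {K : Type*} [Field K] [Fintype K]
    [DecidableEq K] {q : ℕ} (hq : IsPrimePow q) (hq3 : q % 3 = 2)
    (hK : Fintype.card K = q ^ 2) :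
    (Finset.univ.filter fun a : K =>
      a ^ (3 * (q - 1)) = 1 ∧ (-1 - a) ^ (3 * (q - 1)) = 1).card = q := by
  have hadd := FiniteField.add_pow_of_card_eq_sq hq hK
  have hq2 : 2 ≤ q := hq.two_le
  have hsq : Fintype.card K - 1 = (q - 1) * (q + 1) := by
    rw [hK, mul_comm, ← Nat.sq_sub_sq, one_pow]
  have hpow : ∀ x : K, x ^ q = x ^ (q - 1) * x := fun x => by
    rw [← pow_succ, Nat.sub_add_cancel (by omega)]
  obtain ⟨ω, hω⟩ := FiniteField.exists_isPrimitiveRoot_of_dvd (K := K) (d := 3)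
    (hsq ▸ Dvd.dvd.mul_left (by omega) _)
  obtain ⟨ζ, hζ⟩ := FiniteField.exists_isPrimitiveRoot_of_dvd (K := K) (d := q - 1)
    (hsq ▸ Dvd.intro _ rfl)
  have hω3 : ω ^ 3 = 1 := hω.pow_eq_one
  have hω1 : ω ≠ 1 := hω.ne_one (by norm_num)
  have hω0 : ω ≠ 0 := hω.ne_zero (by norm_num)
  have hωs : ω ^ 2 + ω + 1 = 0 := by
    apply mul_left_cancel₀ (sub_ne_zero.2 hω1)
    linear_combination hω3
  have hωq : ω ^ (q - 1) = ω := by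
    have : q - 1 = 3 * (q / 3) + 1 := by omega
    rw [this, pow_succ, pow_mul, hω3, one_pow, one_mul]
  have hneg : (-1 : K) ^ (q - 1) = 1 := by
    have h := hadd 1 (-1)
    rw [add_neg_cancel, zero_pow (by omega), one_pow, hpow] at h
    linear_combination h
  have hcube : ∀ x : K, x ^ (3 * (q - 1)) = 1 ↔
      x ^ (q - 1) = 1 ∨ x ^ (q - 1) = ω ∨ x ^ (q - 1) = ω ^ 2 := fun x => by
    rw [mul_comm, pow_mul]
    generalize x ^ (q - 1) = t
    constructor
    · intro ht
      have : (t - 1) * ((t - ω) * (t - ω ^ 2)) = 0 := by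
        linear_combination ht + (-t^2 + t * ω) * hωs - hω3
      simpa [sub_eq_zero] using this
    · rintro (rfl | rfl | rfl)
      · simp
      · exact hω3
      · rw [← pow_mul, mul_comm, pow_mul, hω3, one_pow]
  have hω2 : ω ^ 2 ≠ ω := fun h => hω1 (mul_left_cancel₀ hω0 (by linear_combination h))
  have hω21 : ω ^ 2 ≠ 1 := fun h => hω1 (by linear_combination hω3 - ω * h)
  have hnegω : -1 - ω = ω ^ 2 := by linear_combination -hωs
  have hnegω2 : -1 - ω ^ 2 = ω := by linear_combination -hωs
  have hω2q : (ω ^ 2) ^ (q - 1) = ω ^ 2 := by rw [← pow_mul, mul_comm, pow_mul, hωq]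
  have hroots : ∀ x : K, x ∈ Polynomial.nthRootsFinset (q - 1) (1 : K) ↔ x ^ (q - 1) = 1 :=
    fun x => Polynomial.mem_nthRootsFinset (by omega) 1
  have hset : (Finset.univ.filter fun a : K =>
      a ^ (3 * (q - 1)) = 1 ∧ (-1 - a) ^ (3 * (q - 1)) = 1) =
      (Polynomial.nthRootsFinset (q - 1) (1 : K)).erase (-1) ∪ {ω, ω ^ 2} := by
    ext a
    simp only [Finset.mem_filter, Finset.mem_univ, true_and, Finset.mem_union, Finset.mem_erase,
      Finset.mem_insert, Finset.mem_singleton, hroots]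
    constructor
    · rintro ⟨h1, h2⟩
      have ha0 : a ≠ 0 := by
        rintro rfl
        rw [zero_pow (by omega)] at h1
        exact zero_ne_one h1
      have hb0 : a + 1 ≠ 0 := by
        intro h
        rw [show -1 - a = 0 by linear_combination -h, zero_pow (by omega)] at h2
        exact zero_ne_one h2
      have h := hadd a 1
      rw [hcube] at h1 h2
      rw [show -1 - a = (-1) * (a + 1) by ring, mul_pow, hneg, one_mul] at h2
      rw [hpow, hpow a, one_pow] at h
      have hω10 : ω - 1 ≠ 0 := sub_ne_zero.2 hω1
      rcases h1 with h1 | h1 | h1 <;> rcases h2 with h2 | h2 | h2 <;> rw [h1, h2] at h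
      · exact .inl ⟨fun h' => hb0 (by rw [h']; ring), h1⟩
      · exact absurd (mul_left_cancel₀ hω10 (by linear_combination h)) hb0
      · exact absurd (mul_left_cancel₀ (sub_ne_zero.2 hω21) (by linear_combination h)) hb0
      · exact absurd (mul_left_cancel₀ hω10 (by linear_combination -h)) ha0
      · exact absurd (by linear_combination h) hω1
      · refine .inr (.inl (mul_left_cancel₀ (mul_ne_zero hω0 hω10) ?_))
        linear_combination h + (1 - ω) * hωs
      · exact absurd (mul_left_cancel₀ (sub_ne_zero.2 hω21) (by linear_combination -h)) ha0
      · refine .inr (.inr (mul_left_cancel₀ (mul_ne_zero hω0 hω10) ?_))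
        linear_combination -h + (1 - ω) * hωs + (2 - ω) * hω3
      · exact absurd (by linear_combination h) hω21
    · rintro (⟨hne, h1⟩ | rfl | rfl)
      · refine ⟨(hcube a).2 (.inl h1), (hcube _).2 (.inl ?_)⟩
        have hb0 : a + 1 ≠ 0 := fun h => hne (by linear_combination h)
        have h := hadd a 1
        rw [hpow, hpow a, one_pow, h1] at h
        rw [show -1 - a = (-1) * (a + 1) by ring, mul_pow, hneg, one_mul]
        exact mul_right_cancel₀ hb0 (by linear_combination h)
      · rw [hnegω, hcube, hcube]
        exact ⟨.inr (.inl hωq), .inr (.inr hω2q)⟩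
      · rw [hnegω2, hcube, hcube]
        exact ⟨.inr (.inr hω2q), .inr (.inl hωq)⟩
  have hdisj : Disjoint ((Polynomial.nthRootsFinset (q - 1) (1 : K)).erase (-1)) {ω, ω ^ 2} := by
    rw [Finset.disjoint_right]
    intro a ha
    simp only [Finset.mem_insert, Finset.mem_singleton] at ha
    rcases ha with rfl | rfl
    · simp [hroots, hωq, hω1]
    · simp [hroots, hω2q, hω21]
  rw [hset, Finset.card_union_of_disjoint hdisj, Finset.card_erase_of_mem ((hroots _).2 hneg),
    hζ.card_nthRootsFinset, Finset.card_pair hω2.symm]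
  omega

/-- Point-count form of the maximality of the Fermat-type function field
`K(x,y)` with `x^m + y^m + 1 = 0`, `m = (q+1)/3`, over a field with `q^2`
elements. -/
theorem stmt_2 (q : ℕ) (hq : IsPrimePow q) (hq3 : q % 3 = 2)
    (K : Type*) [Field K] [Fintype K] (hK : Fintype.card K = q ^ 2)
    (m : ℕ) (hm : m = (q + 1) / 3) :
    Nat.card {p : K × K // p.1 ^ m + p.2 ^ m + 1 = 0} =
      q ^ 2 + 1 + q * (m - 1) * (m - 2) - m := by
  classical
  have hq2 : 2 ≤ q := hq.two_le
  have hqm : q + 1 = 3 * m := by omega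
  have hm0 : m ≠ 0 := by omega
  have he0 : 3 * (q - 1) ≠ 0 := by omega
  have hcard : Fintype.card K - 1 = m * (3 * (q - 1)) := by
    rw [hK, ← one_pow 2, Nat.sq_sub_sq, hqm, one_pow, mul_assoc, mul_left_comm]
  have hneg : (-1 : K) ^ (3 * (q - 1)) = 1 := by
    have h := FiniteField.add_pow_of_card_eq_sq hq hK (1 : K) (-1)
    rw [add_neg_cancel, zero_pow (by omega), one_pow,
      show q = q - 1 + 1 by omega, pow_succ] at h
    rw [mul_comm, pow_mul, show (-1 : K) ^ (q - 1) = 1 by linear_combination h, one_pow]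
  have hzero : (Finset.univ.filter fun x : K => x ^ m = 0).card = 1 := by
    rw [Finset.card_eq_one]
    exact ⟨0, by ext; simp [hm0]⟩
  have hminus : (Finset.univ.filter fun x : K => x ^ m = -1).card = m := by
    rw [FiniteField.card_filter_pow_eq hcard (neg_ne_zero.2 one_ne_zero), if_pos hneg]
  have hfiber : ∀ a : K,
      (Finset.univ.filter fun x : K => x ^ m = a).card *
        (Finset.univ.filter fun y : K => y ^ m = -1 - a).card =
      (if a = 0 then m else 0) + (if a = -1 then m else 0) +
        if a ^ (3 * (q - 1)) = 1 ∧ (-1 - a) ^ (3 * (q - 1)) = 1 then m * m else 0 := by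
    intro a
    by_cases h0 : a = 0
    · subst h0
      rw [hzero, sub_zero, hminus]
      simp [zero_pow he0]
    by_cases h1 : a = -1
    · subst h1
      rw [sub_self, hzero, hminus]
      simp [zero_pow he0]
    rw [FiniteField.card_filter_pow_eq hcard h0, FiniteField.card_filter_pow_eq hcard
      (fun h => h1 (by linear_combination -h)), if_neg h0, if_neg h1]
    split_ifs <;> simp_all
  have hcount : Nat.card {p : K × K // p.1 ^ m + p.2 ^ m + 1 = 0} = q * (m * m) + 2 * m := by
    rw [Nat.card_eq_fintype_card, Fintype.card_subtype,
      Finset.card_eq_sum_card_fiberwise (f := fun p : K × K => p.1 ^ m) (t := Finset.univ)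
        (fun _ _ => Finset.mem_coe.2 (Finset.mem_univ _))]
    have hprod : ∀ a : K, ((Finset.univ.filter fun p : K × K => p.1 ^ m + p.2 ^ m + 1 = 0).filter
        fun p => p.1 ^ m = a) = (Finset.univ.filter fun x : K => x ^ m = a) ×ˢ
          (Finset.univ.filter fun y : K => y ^ m = -1 - a) := by
      intro a
      ext ⟨x, y⟩
      simp only [Finset.mem_filter, Finset.mem_univ, true_and, Finset.mem_product]
      constructor
      · rintro ⟨h, rfl⟩
        exact ⟨rfl, by linear_combination h⟩
      · rintro ⟨rfl, h⟩
        exact ⟨by linear_combination h, rfl⟩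
    simp only [hprod, Finset.card_product, hfiber, Finset.sum_add_distrib]
    rw [Finset.sum_ite_eq', Finset.sum_ite_eq', ← Finset.sum_filter, Finset.sum_const,
      FiniteField.card_filter_pow_three_mul_sub_one hq hq3 hK]
    simp only [Finset.mem_univ, if_true, smul_eq_mul]
    ring
  rw [hcount]
  obtain rfl | hm2 : m = 1 ∨ 2 ≤ m := by omega
  · obtain rfl : q = 2 := by omega
    norm_num
  · obtain ⟨n, rfl⟩ := Nat.exists_eq_add_of_le' hm2
    obtain rfl : q = 3 * n + 5 := by omega
    refine (Nat.sub_eq_of_eq_add ?_).symm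
    rw [show n + 2 - 1 = n + 1 by omega, Nat.add_sub_cancel]
    ring
end

section
/- Let q be a prime power with q ≡ 2 (mod 3), let K be a finite field with exactly q² elements, and let m = (q+1)/3. Then the number of pairs (α, β) ∈ K × K with α ≠ 0, β ≠ 0, and α^m + β^m + 1 = 0 equals q² + 1 + q(m−1)(m−2) − (q+1). -/
open Finset in
/-- If `d` divides the order of the multiplicative group of a finite field, with cofactor `n`, then
every `n`-th root of unity has exactly `d` distinct `d`-th roots. -/
theorem FiniteField.card_filter_pow_eq_s3 {K : Type*} [Field K] [Fintype K] [DecidableEq K]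
    {d n : ℕ} (h : Fintype.card K - 1 = d * n) {u : K} (hu : u ^ n = 1) :
    #{x : K | x ^ d = u} = d := by
  have hcard : Nat.card Kˣ = d * n := by rw [Nat.card_units, Nat.card_eq_fintype_card, h]
  have hpos : 0 < d * n := hcard ▸ Nat.card_pos
  have hd : 0 < d := Nat.pos_of_mul_pos_right hpos
  have hn : 0 < n := Nat.pos_of_mul_pos_left hpos
  have hu0 : u ≠ 0 := by
    rintro rfl
    simp [hn.ne'] at hu
  have hrange : (powMonoidHom d : Kˣ →* Kˣ).range = (powMonoidHom n : Kˣ →* Kˣ).ker := by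
    apply Subgroup.eq_of_le_of_card_ge
    · rintro _ ⟨y, rfl⟩
      simp only [MonoidHom.mem_ker, powMonoidHom_apply, ← pow_mul, ← hcard, pow_card_eq_one']
    · rw [IsCyclic.card_powMonoidHom_range, IsCyclic.card_powMonoidHom_ker, hcard,
        Nat.gcd_mul_left_left, Nat.gcd_mul_right_left, Nat.mul_div_cancel_left _ hd]
  have hmem : Units.mk0 u hu0 ∈ (powMonoidHom d : Kˣ →* Kˣ).range := by
    rw [hrange, MonoidHom.mem_ker]
    ext
    simpa using hu
  have hfiber := MonoidHom.card_fiber_eq_of_mem_range (powMonoidHom d : Kˣ →* Kˣ)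
    (x := Units.mk0 u hu0) (y := 1) hmem ⟨1, by simp⟩
  have hker : #{x : Kˣ | powMonoidHom d x = 1} = d := by
    have := IsCyclic.card_powMonoidHom_ker (G := Kˣ) d
    rw [hcard, Nat.gcd_mul_right_left] at this
    refine (Nat.subtype_card _ fun x => ?_).symm.trans this
    simp
  refine Eq.trans (Eq.symm ?_) (hfiber.trans hker)
  apply Finset.card_bij (fun (x : Kˣ) _ => (x : K))
  · intro x hx
    simpa [Units.ext_iff] using hx
  · intro x _ y _ hxy
    exact Units.ext hxy
  · intro x hx
    have hx' : x ^ d = u := by simpa using hx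
    have hx0 : x ≠ 0 := by
      rintro rfl
      exact hu0 (by rw [← hx', zero_pow hd.ne'])
    exact ⟨Units.mk0 x hx0, by simpa [Units.ext_iff] using hx', rfl⟩

open Finset in
/-- The points of `x ^ m + y ^ m + 1 = 0` with nonzero coordinates, counted by means of pairs of
`m`-th powers with sum `-1`. -/
theorem FiniteField.card_filter_pow_add_pow_add_one {K : Type*} [Field K] [Fintype K]
    [DecidableEq K] {m n : ℕ} (h : Fintype.card K - 1 = m * n) :
    #{p : K × K | p.1 ≠ 0 ∧ p.2 ≠ 0 ∧ p.1 ^ m + p.2 ^ m + 1 = 0} =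
      #{u : K | u ^ n = 1 ∧ (-1 - u) ^ n = 1} * (m * m) := by
  have hpos : 0 < m * n := by
    have := Fintype.one_lt_card (α := K)
    omega
  have hm : m ≠ 0 := (Nat.pos_of_mul_pos_right hpos).ne'
  have hn : n ≠ 0 := (Nat.pos_of_mul_pos_left hpos).ne'
  have hroot {x : K} (hx : x ≠ 0) : (x ^ m) ^ n = 1 := by
    rw [← pow_mul, ← h, FiniteField.pow_card_sub_one_eq_one x hx]
  have hne {x u : K} (hu : u ^ n = 1) (hx : x ^ m = u) : x ≠ 0 := by
    rintro rfl
    rw [zero_pow hm] at hx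
    simp [← hx, hn] at hu
  rw [card_eq_sum_card_fiberwise (f := fun p : K × K => p.1 ^ m)
    (t := ({u : K | u ^ n = 1 ∧ (-1 - u) ^ n = 1} : Finset K))]
  · rw [sum_const_nat]
    intro u hu
    obtain ⟨hu1, hu2⟩ : u ^ n = 1 ∧ (-1 - u) ^ n = 1 := by simpa using hu
    have hprod : ({p ∈ ({p : K × K | p.1 ≠ 0 ∧ p.2 ≠ 0 ∧ p.1 ^ m + p.2 ^ m + 1 = 0} :
        Finset (K × K)) | p.1 ^ m = u} : Finset (K × K)) =
        ({x : K | x ^ m = u} : Finset K) ×ˢ ({y : K | y ^ m = -1 - u} : Finset K) := by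
      ext ⟨x, y⟩
      simp only [mem_filter, mem_univ, true_and, mem_product]
      constructor
      · rintro ⟨⟨-, -, hxy⟩, hx⟩
        exact ⟨hx, by linear_combination hxy - hx⟩
      · rintro ⟨hx, hy⟩
        exact ⟨⟨hne hu1 hx, hne hu2 hy, by linear_combination hx + hy⟩, hx⟩
    rw [hprod, card_product, card_filter_pow_eq_s3 h hu1, card_filter_pow_eq_s3 h hu2]
  · rintro ⟨x, y⟩ hp
    obtain ⟨hx, hy, hxy⟩ : x ≠ 0 ∧ y ≠ 0 ∧ x ^ m + y ^ m + 1 = 0 := by simpa using hp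
    have hy' : -1 - x ^ m = y ^ m := by linear_combination -hxy
    simp [hy', hroot hx, hroot hy]

open Finset in
/-- In a finite field with `q ^ 2` elements, where `q ≡ 2 (mod 3)`, there are `q` pairs of
`3 (q - 1)`-th roots of unity with sum `-1`. -/
theorem FiniteField.card_filter_pow_eq_one_and_neg_one_sub {K : Type*} [Field K] [Fintype K]
    [DecidableEq K] {q : ℕ} (hq : IsPrimePow q) (hq3 : q % 3 = 2)
    (hK : Fintype.card K = q ^ 2) :
    #{u : K | u ^ (3 * (q - 1)) = 1 ∧ (-1 - u) ^ (3 * (q - 1)) = 1} = q := by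
  have hadd := add_pow_of_card_eq_sq hq hK
  obtain ⟨j, hj⟩ : ∃ j, q = 3 * j + 2 := ⟨q / 3, by omega⟩
  have hcard : Fintype.card K - 1 = (q - 1) * (q + 1) := by
    rw [hK, mul_comm, ← Nat.sq_sub_sq, one_pow]
  have hsucc (x : K) : x ^ q = x ^ (q - 1) * x := by
    rw [← pow_succ, show q - 1 + 1 = q by omega]
  have hneg : (-1 : K) ^ q = -1 := by
    have := hadd 1 (-1)
    rw [add_neg_cancel, zero_pow (by omega), one_pow] at this
    linear_combination -this
  have hneg' : (-1 : K) ^ (q - 1) = 1 := by linear_combination hsucc (-1) - hneg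
  obtain ⟨w, hw3, hw⟩ : ∃ w : K, w ^ 3 = 1 ∧ w ^ 2 + w + 1 = 0 ∧ w ≠ 1 := by
    have := Fact.mk Nat.prime_three
    have hdvd : 3 ∣ Nat.card Kˣ := by
      rw [Nat.card_units, Nat.card_eq_fintype_card, hcard]
      exact Dvd.dvd.mul_left (by omega) _
    obtain ⟨w, hw⟩ := exists_prime_orderOf_dvd_card' 3 hdvd
    have h3 : (w : K) ^ 3 = 1 := by
      rw [← Units.val_pow_eq_pow_val, ← hw, pow_orderOf_eq_one, Units.val_one]
    have h1 : (w : K) ≠ 1 := by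
      intro h
      rw [Units.val_eq_one] at h
      simp [h] at hw
    refine ⟨w, h3, mul_left_cancel₀ (sub_ne_zero.2 h1) ?_, h1⟩
    linear_combination h3
  obtain ⟨hw2, hw1⟩ := hw
  have hwq : w ^ (q - 1) = w := by
    rw [hj, show 3 * j + 2 - 1 = 3 * j + 1 by omega, pow_succ, pow_mul, hw3, one_pow, one_mul]
  have hw2q : (w ^ 2) ^ (q - 1) = w ^ 2 := by rw [← pow_mul, mul_comm, pow_mul, hwq]
  have hwsq1 : w ^ 2 ≠ 1 := by
    intro h
    apply hw1
    linear_combination hw3 - w * h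
  have hwsq : w ≠ w ^ 2 := by
    intro h
    apply hwsq1
    linear_combination hw3 + w * h
  have hfix {ζ u : K} (hu : u ^ (q - 1) = ζ) : u ^ q = ζ * u := by rw [hsucc, hu]
  have hset : ({u : K | u ^ (3 * (q - 1)) = 1 ∧ (-1 - u) ^ (3 * (q - 1)) = 1} : Finset K) =
      insert w (insert (w ^ 2) (({u : K | u ^ (q - 1) = 1} : Finset K).erase (-1))) := by
    ext u
    simp only [mem_filter, mem_univ, true_and, mem_insert, mem_erase]
    constructor
    · rintro ⟨hu, hv⟩
      have hne {x : K} (hx : x ^ (3 * (q - 1)) = 1) : x ≠ 0 := by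
        rintro rfl
        rw [zero_pow (by omega)] at hx
        exact zero_ne_one hx
      have hu0 := hne hu
      have hv0 := hne hv
      have hroots {x : K} (hx : x ^ (3 * (q - 1)) = 1) :
          x ^ (q - 1) = 1 ∨ x ^ (q - 1) = w ∨ x ^ (q - 1) = w ^ 2 := by
        rw [mul_comm, pow_mul] at hx
        generalize x ^ (q - 1) = ζ at hx
        have : (ζ - 1) * ((ζ - w) * (ζ - w ^ 2)) = 0 := by
          linear_combination hx - hw3 - ζ ^ 2 * hw2 + ζ * w * hw2
        simpa only [mul_eq_zero, sub_eq_zero] using this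
      have hsum : u ^ q + (-1 - u) ^ q = -1 := by
        rw [← hadd, add_sub_cancel, hneg]
      have hw0 : w - 1 ≠ 0 := sub_ne_zero.2 hw1
      have hwsq0 : w ^ 2 - 1 ≠ 0 := sub_ne_zero.2 hwsq1
      have hwd : w - w ^ 2 ≠ 0 := sub_ne_zero.2 hwsq
      rcases hroots hu with h | h | h <;> rcases hroots hv with h' | h' | h' <;>
        rw [hfix h, hfix h'] at hsum
      · refine .inr (.inr ⟨?_, h⟩)
        rintro rfl
        simp at hv0
      · exact absurd (mul_left_cancel₀ hw0 (by linear_combination hsum)) hv0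
      · exact absurd (mul_left_cancel₀ hwsq0 (by linear_combination hsum)) hv0
      · exact absurd (mul_left_cancel₀ hw0 (by linear_combination hsum)) hu0
      · exact absurd (by linear_combination -hsum) hw1
      · exact .inl (mul_left_cancel₀ hwd (by linear_combination hsum + hw3))
      · exact absurd (mul_left_cancel₀ hwsq0 (by linear_combination hsum)) hu0
      · refine .inr (.inl (mul_left_cancel₀ hwd ?_))
        linear_combination -hsum + (w - 1) * hw3
      · exact absurd (by linear_combination -hsum) hwsq1
    · have hcube {x ζ : K} (hx : x ^ (q - 1) = ζ) (hζ : ζ ^ 3 = 1) : x ^ (3 * (q - 1)) = 1 := by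
        rw [mul_comm, pow_mul, hx, hζ]
      have hcw := hcube hwq hw3
      have hcw2 := hcube hw2q (by linear_combination (w ^ 3 + 1) * hw3)
      rintro (rfl | rfl | ⟨hu, h⟩)
      · exact ⟨hcw, by rwa [show -1 - u = u ^ 2 by linear_combination -hw2]⟩
      · exact ⟨hcw2, by rwa [show -1 - w ^ 2 = w by linear_combination -hw2]⟩
      · refine ⟨hcube h (one_pow 3), hcube (mul_right_cancel₀ (b := -1 - u) ?_ ?_) (one_pow 3)⟩
        · intro h0
          exact hu (by linear_combination -h0)
        · have := hadd (-1 - u) u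
          rw [sub_add_cancel, hneg, hfix h, hsucc] at this
          linear_combination -this
  rw [hset, card_insert_of_notMem, card_insert_of_notMem, card_erase_of_mem,
    card_filter_pow_eq_s3 hcard (one_pow _)]
  · omega
  · simpa using hneg'
  · simp [hw2q, hwsq1]
  · simp [hwq, hw1, hwsq]

/-- Count of affine points with nonzero coordinates on the Fermat-type curve
`x^m + y^m + 1 = 0`, `m = (q+1)/3`, over a field with `q^2` elements. -/
theorem stmt_3 (q : ℕ) (hq : IsPrimePow q) (hq3 : q % 3 = 2)
    (K : Type*) [Field K] [Fintype K] (hK : Fintype.card K = q ^ 2)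
    (m : ℕ) (hm : m = (q + 1) / 3) :
    Nat.card {p : K × K // p.1 ≠ 0 ∧ p.2 ≠ 0 ∧ p.1 ^ m + p.2 ^ m + 1 = 0} =
      q ^ 2 + 1 + q * (m - 1) * (m - 2) - (q + 1) := by
  classical
  obtain ⟨k, rfl⟩ : ∃ k, m = k + 1 := ⟨m - 1, by omega⟩
  obtain rfl : q = 3 * k + 2 := by omega
  have hcard : Fintype.card K - 1 = (k + 1) * (3 * (3 * k + 2 - 1)) := by
    rw [hK, show 3 * k + 2 - 1 = 3 * k + 1 by omega, Nat.sub_eq_iff_eq_add (Nat.one_le_pow _ _ (by omega))]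
    ring
  rw [Nat.subtype_card {p : K × K | p.1 ≠ 0 ∧ p.2 ≠ 0 ∧ p.1 ^ (k + 1) + p.2 ^ (k + 1) + 1 = 0}
      (fun p => by simp),
    FiniteField.card_filter_pow_add_pow_add_one hcard,
    FiniteField.card_filter_pow_eq_one_and_neg_one_sub hq hq3 hK]
  symm
  apply Nat.sub_eq_of_eq_add
  obtain - | k := k
  · norm_num
  · simp only [Nat.add_sub_cancel, show k + 1 + 1 - 2 = k by omega]
    ring
end

section
/- Let q be a prime power with q ≡ 2 (mod 3), let K be a finite field with exactly q² elements, let m = (q+1)/3, and let w ∈ K satisfy w^m = 3. If α, β ∈ K satisfy α·β ≠ 0 and α^m + β^m + 1 = 0, then the equation λ³ = w·α·β has exactly 3 distinct solutions λ ∈ K. -/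
/-- In a finite field with `d * e` nonzero elements, a nonzero `a` with `a ^ e = 1` has exactly
`d` distinct `d`-th roots. -/
theorem FiniteField.natCard_pow_eq {K : Type*} [Field K] [Fintype K] {d e : ℕ} (hd : 0 < d)
    (he : 0 < e) (hcard : Fintype.card K - 1 = d * e) {a : K} (ha : a ≠ 0) (hae : a ^ e = 1) :
    Nat.card {l : K // l ^ d = a} = d := by
  classical
  obtain ⟨g, hg⟩ := IsCyclic.exists_generator (α := Kˣ)
  have hord : orderOf g = d * e := by
    rw [orderOf_eq_card_of_forall_mem_zpowers hg, Nat.card_eq_fintype_card,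
      Fintype.card_units, hcard]
  have hprim : IsPrimitiveRoot (g : K) (d * e) :=
    IsPrimitiveRoot.coe_units_iff.mpr (hord ▸ IsPrimitiveRoot.orderOf g)
  have hζ : IsPrimitiveRoot ((g : K) ^ e) d := hprim.pow (Nat.mul_pos hd he) (mul_comm d e)
  obtain ⟨k, hk⟩ := mem_powers_iff_mem_zpowers.mpr (hg (Units.mk0 a ha))
  have hgk : (g : K) ^ k = a := by simpa using congrArg Units.val hk
  have hdk : d ∣ k := by
    rw [← hgk, ← pow_mul] at hae
    exact Nat.dvd_of_mul_dvd_mul_right he (hprim.dvd_of_pow_eq_one _ hae)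
  obtain ⟨j, rfl⟩ := hdk
  have hroot : ∃ x : K, x ^ d = a := ⟨(g : K) ^ j, by rw [← hgk, ← pow_mul, mul_comm]⟩
  have hnodup := hζ.nthRoots_nodup ha
  rw [Nat.card_eq_fintype_card,
    Fintype.card_of_subtype (Polynomial.nthRoots d a).toFinset
      (fun x => by rw [Multiset.mem_toFinset, Polynomial.mem_nthRoots hd]),
    Multiset.toFinset_card_of_nodup hnodup, hζ.card_nthRoots, if_pos hroot]

/-- For `α, β` with `αβ ≠ 0` and `α^m + β^m + 1 = 0`, the equation
`λ^3 = w·α·β` has exactly 3 solutions in `K`. -/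
theorem stmt_4 (q : ℕ) (hq : IsPrimePow q) (hq3 : q % 3 = 2)
    (K : Type*) [Field K] [Fintype K] (hK : Fintype.card K = q ^ 2)
    (m : ℕ) (hm : m = (q + 1) / 3) (w : K) (hw : w ^ m = 3)
    (α β : K) (hαβ : α * β ≠ 0) (hab : α ^ m + β ^ m + 1 = 0) :
    Nat.card {l : K // l ^ 3 = w * α * β} = 3 := by
  have h3m : m * 3 = q + 1 := by omega
  have hm0 : m ≠ 0 := by omega
  have hq1 : 0 < q - 1 := by omega
  have hqK : (q : K) = 0 := by
    have h : ((Fintype.card K : ℕ) : K) = 0 := Nat.cast_card_eq_zero K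
    rw [hK, Nat.cast_pow] at h
    exact pow_eq_zero_iff two_ne_zero |>.mp h
  have h3 : (3 : K) ≠ 0 := by
    intro h3
    have h : ((m * 3 : ℕ) : K) = ((q + 1 : ℕ) : K) := congrArg _ h3m
    push_cast at h
    rw [h3, hqK] at h
    simp at h
  have hw0 : w ≠ 0 := by
    rintro rfl
    exact h3 (by rw [← hw, zero_pow hm0])
  have ha : w * α * β ≠ 0 := by rw [mul_assoc]; exact mul_ne_zero hw0 hαβ
  have hadd : ∀ x y : K, (x + y) ^ q = x ^ q + y ^ q := by
    obtain ⟨p, k, hp, -, rfl⟩ := hq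
    have : Fact p.Prime := ⟨hp.nat_prime⟩
    have : CharP K p := charP_of_card_eq_prime_pow (f := k * 2) (by
      rw [hK, ← pow_mul])
    exact fun x y => add_pow_char_pow x y p k
  have hnorm : ∀ x : K, ((x ^ m) ^ 3) ^ q = (x ^ m) ^ 3 := by
    intro x
    have hx : x ^ (q ^ 2) = x := hK ▸ FiniteField.pow_card x
    rw [← pow_mul x, h3m, ← pow_mul, show (q + 1) * q = q ^ 2 + q by ring, pow_add, hx, pow_succ']
  have hcubes : (w * α * β) ^ m = (α ^ m) ^ 3 + (β ^ m) ^ 3 + 1 := by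
    rw [mul_pow, mul_pow, hw]
    have hb : β ^ m = -1 - α ^ m := by linear_combination hab
    rw [hb]
    ring
  have hfix : ((w * α * β) ^ m) ^ q = (w * α * β) ^ m := by
    rw [hcubes, hadd, hadd, hnorm, hnorm, one_pow]
  have hone : (w * α * β) ^ (m * (q - 1)) = 1 := by
    rw [pow_mul]
    apply mul_left_cancel₀ (pow_ne_zero m ha)
    rw [← pow_succ', Nat.sub_add_cancel (by omega), hfix, mul_one]
  refine FiniteField.natCard_pow_eq three_pos (Nat.mul_pos (by omega) hq1) ?_ ha hone
  rw [hK, ← mul_assoc, mul_comm 3 m, h3m, ← Nat.sq_sub_sq, one_pow]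
end

section
/- Let q be a prime power with q ≡ 2 (mod 3), let K be a finite field with exactly q² elements, and let m = (q+1)/3. If α, β ∈ K satisfy α^m + β^m + 1 = 0, then 3·(α·β)^m = α^{q+1} + β^{q+1} + 1; moreover, if in addition α·β ≠ 0, then (3·(α·β)^m)^{q−1} = 1 (i.e., 3·(α·β)^m is a nonzero element of the subfield with q elements). -/
theorem pow_succ_pow_eq_self_of_card_eq_sq {K : Type*} [Field K] [Fintype K] {q : ℕ}
    (hK : Fintype.card K = q ^ 2) (x : K) : (x ^ (q + 1)) ^ q = x ^ (q + 1) := by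
  calc (x ^ (q + 1)) ^ q = x ^ q ^ 2 * x ^ q := by ring
    _ = x * x ^ q := by rw [← hK, FiniteField.pow_card]
    _ = x ^ (q + 1) := by ring

/-- If `α^m + β^m + 1 = 0` with `m = (q+1)/3`, then
`3(αβ)^m = α^{q+1} + β^{q+1} + 1`, and if moreover `αβ ≠ 0` then
`(3(αβ)^m)^{q-1} = 1`. -/
theorem stmt_5 (q : ℕ) (hq : IsPrimePow q) (hq3 : q % 3 = 2)
    (K : Type*) [Field K] [Fintype K] (hK : Fintype.card K = q ^ 2)
    (m : ℕ) (hm : m = (q + 1) / 3)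
    (α β : K) (hab : α ^ m + β ^ m + 1 = 0) :
    3 * (α * β) ^ m = α ^ (q + 1) + β ^ (q + 1) + 1 ∧
      (α * β ≠ 0 → (3 * (α * β) ^ m) ^ (q - 1) = 1) := by
  obtain ⟨p, k, hp, hk, rfl⟩ := (isPrimePow_nat_iff q).1 hq
  have : Fact p.Prime := ⟨hp⟩
  have : CharP K p := charP_of_card_eq_prime_pow (f := k * 2) (by rw [hK, pow_mul])
  have h3 : (3 : K) ≠ 0 := by
    intro h
    have hdvd : p ∣ 3 := (CharP.cast_eq_zero_iff K p 3).1 (mod_cast h)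
    obtain rfl := (Nat.prime_dvd_prime_iff_eq hp Nat.prime_three).1 hdvd
    have := dvd_pow_self 3 hk.ne'
    omega
  have hm3 : p ^ k + 1 = m * 3 := by omega
  have key : 3 * (α * β) ^ m = α ^ (p ^ k + 1) + β ^ (p ^ k + 1) + 1 := by
    rw [hm3, pow_mul, pow_mul, mul_pow]
    linear_combination
      -((α ^ m) ^ 2 + (β ^ m) ^ 2 + 1 - α ^ m * β ^ m - α ^ m - β ^ m) * hab
  refine ⟨key, fun h0 => ?_⟩
  have hne : 3 * (α * β) ^ m ≠ 0 := mul_ne_zero h3 (pow_ne_zero _ h0)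
  have hfix : (3 * (α * β) ^ m) ^ p ^ k = 3 * (α * β) ^ m := by
    rw [key, add_pow_char_pow, add_pow_char_pow, one_pow,
      pow_succ_pow_eq_self_of_card_eq_sq hK, pow_succ_pow_eq_self_of_card_eq_sq hK]
  apply mul_right_cancel₀ hne
  rw [pow_sub_one_mul (pow_ne_zero _ hp.ne_zero), hfix, one_mul]
end

section
/- For all natural numbers i and j with 3·i ≥ 8·j, the natural number 7·i − 16·j (which is non-negative, since 3i ≥ 8j implies 7i ≥ 16j) belongs to the additive submonoid of ℕ generated by {5, 7, 8}. (This is the numerical-semigroup form of the statement that 7i − 16j is a non-gap at the place P̄_∞ of the function field F_49(t,z) with z^16 = t(t+1)^6, proved by exhibiting the function z^i(t+1)^{−j} with pole divisor (7i−16j)·P̄_∞.) -/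
/-- Nonnegative combinations of `5`, `7`, `8` lie in the semigroup they generate. -/
theorem combination_mem_closure (a b c : ℕ) :
    5 * a + 7 * b + 8 * c ∈ AddSubmonoid.closure ({5, 7, 8} : Set ℕ) := by
  have multiple_mem {g : ℕ} (hg : g ∈ ({5, 7, 8} : Set ℕ)) (n : ℕ) :
      g * n ∈ AddSubmonoid.closure ({5, 7, 8} : Set ℕ) := by
    simpa [mul_comm] using AddSubmonoid.nsmul_mem _ (AddSubmonoid.subset_closure hg) n
  exact add_mem (add_mem (multiple_mem (by simp) a) (multiple_mem (by simp) b))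
    (multiple_mem (by simp) c)

/-- For natural numbers `i, j` with `3i ≥ 8j`, the number `7i - 16j` lies in
the numerical semigroup generated by `{5, 7, 8}`. -/
theorem stmt_9 (i j : ℕ) (h : 3 * i ≥ 8 * j) :
    7 * i - 16 * j ∈ AddSubmonoid.closure ({5, 7, 8} : Set ℕ) := by
  rcases le_total (3 * j) i with hij | hij
  · convert combination_mem_closure j (i - 3 * j) 0 using 1
    omega
  · convert combination_mem_closure (3 * i - 8 * j) 0 (3 * j - i) using 1
    omega
end

section
/- Let r ≥ 2 be a prime power. Then the complement in ℕ of the additive submonoid of ℕ generated by {r³ − r² + r, r³, r³ + 1} has exactly (1/2)(r³ + 1)(r² − 2) + 1 elements. (This is the statement that the Weierstrass semigroup at a fully ramified rational place of the GK function field over F_{r⁶} is generated by r³ − r² + r, r³, r³ + 1, combined with the fact that the number of gaps of a Weierstrass semigroup equals the genus, which for the GK function field is (1/2)(r³+1)(r²−2) + 1.) -/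
/-- Membership in an additive submonoid of `ℕ` with three generators. -/
theorem Nat.mem_closure_triple {a b c n : ℕ} :
    n ∈ AddSubmonoid.closure ({a, b, c} : Set ℕ) ↔
      ∃ x y z : ℕ, n = a * x + b * y + c * z := by
  constructor
  · intro h
    induction h using AddSubmonoid.closure_induction with
    | mem x hx =>
      rcases hx with rfl | rfl | rfl
      · exact ⟨1, 0, 0, by simp⟩
      · exact ⟨0, 1, 0, by simp⟩
      · exact ⟨0, 0, 1, by simp⟩
    | zero => exact ⟨0, 0, 0, by simp⟩
    | add u v _ _ hu hv =>
      obtain ⟨x, y, z, rfl⟩ := hu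
      obtain ⟨x', y', z', rfl⟩ := hv
      exact ⟨x + x', y + y', z + z', by ring⟩
  · rintro ⟨x, y, z, rfl⟩
    have key : ∀ g ∈ ({a, b, c} : Set ℕ), ∀ k : ℕ,
        g * k ∈ AddSubmonoid.closure ({a, b, c} : Set ℕ) := fun g hg k => by
      simpa [mul_comm] using nsmul_mem (AddSubmonoid.subset_closure hg) k
    exact add_mem (add_mem (key a (by simp) x) (key b (by simp) y)) (key c (by simp) z)

/-- A set of naturals containing exactly one of `n` and `F - n` for each integer `n`
has `(F + 1) / 2` gaps. -/
theorem Set.two_mul_ncard_compl_of_symmetric {S : Set ℕ} {F : ℕ}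
    (hsymm : ∀ n ≤ F, n ∈ S ↔ F - n ∉ S) (hlarge : ∀ n, F < n → n ∈ S) :
    2 * Sᶜ.ncard = F + 1 := by
  classical
  have hS : Sᶜ = ((Finset.range (F + 1)).filter (· ∉ S) : Finset ℕ) := by
    ext n
    have := hlarge n
    simp only [Set.mem_compl_iff, Finset.coe_filter, Finset.mem_range, Set.mem_ofPred_eq]
    grind
  have hcard : ((Finset.range (F + 1)).filter (· ∈ S)).card =
      ((Finset.range (F + 1)).filter (· ∉ S)).card := by
    refine Finset.card_nbij' (F - ·) (F - ·) ?_ ?_ ?_ ?_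
    · intro n hn
      simp only [Finset.coe_filter, Finset.mem_range, Set.mem_ofPred_eq] at hn ⊢
      exact ⟨by omega, (hsymm n (by omega)).1 hn.2⟩
    · intro n hn
      simp only [Finset.coe_filter, Finset.mem_range, Set.mem_ofPred_eq] at hn ⊢
      refine ⟨by omega, (hsymm (F - n) (by omega)).2 ?_⟩
      rw [Nat.sub_sub_self (by omega)]
      exact hn.2
    all_goals
      intro n hn
      simp only [Finset.coe_filter, Finset.mem_range, Set.mem_ofPred_eq] at hn
      exact Nat.sub_sub_self (by omega)
  have htotal := Finset.card_filter_add_card_filter_not (s := Finset.range (F + 1)) (· ∈ S)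
  rw [Finset.card_range] at htotal
  rw [hS, Set.ncard_coe_finset]
  omega

/-- Every integer is a combination of the three generators whose last two coefficients are
reduced. -/
theorem Int.exists_gk_normal_form {r : ℤ} (hr : 2 ≤ r) (n : ℤ) :
    ∃ i j k : ℤ, 0 ≤ j ∧ j ≤ r ^ 2 - r ∧ 0 ≤ k ∧ k ≤ r - 1 ∧
      n = (r ^ 3 - r ^ 2 + r) * i + r ^ 3 * j + (r ^ 3 + 1) * k := by
  have hm : 0 < r ^ 2 - r + 1 := by nlinarith
  set j := (-n) % (r ^ 2 - r + 1)
  set q := (-n) / (r ^ 2 - r + 1)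
  have hnj : (r ^ 2 - r + 1) * q + j = -n := Int.mul_ediv_add_emod _ _
  have hj0 : 0 ≤ j := Int.emod_nonneg _ hm.ne'
  have hj1 : j < r ^ 2 - r + 1 := Int.emod_lt_of_pos _ hm
  set t := -q - (r + 1) * j with ht
  have hnt : r * (t / r) + t % r = t := Int.mul_ediv_add_emod _ _
  have hk0 : 0 ≤ t % r := Int.emod_nonneg _ (by omega)
  have hk1 : t % r < r := Int.emod_lt_of_pos _ (by omega)
  refine ⟨t / r - t % r, j, t % r, hj0, by omega, hk0, by omega, ?_⟩
  linear_combination hnj - (r ^ 2 - r + 1) * hnt - (r ^ 2 - r + 1) * ht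

/-- The Frobenius number `r⁵ - 2r³ + r² - 1` is not a nonnegative combination of the
generators. -/
theorem Int.gk_frobenius_ne {r x y z : ℤ} (hr : 2 ≤ r) (hx : 0 ≤ x) (hy : 0 ≤ y) (hz : 0 ≤ z) :
    r ^ 5 - 2 * r ^ 3 + r ^ 2 - 1 ≠
      (r ^ 3 - r ^ 2 + r) * x + r ^ 3 * y + (r ^ 3 + 1) * z := by
  intro h
  have hm : 0 < r ^ 2 - r + 1 := by nlinarith
  obtain ⟨u, hu⟩ : r ^ 2 - r + 1 ∣ y + 1 :=
    ⟨r * (x + 1) + (r + 1) * (y + 1) + (r + 1) * (z + 1) - r ^ 3 - (r + 1) * r, by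
      linear_combination h⟩
  have hu0 : 0 < u := by
    by_contra hneg
    nlinarith
  have h' : r * (x + 1) + r ^ 3 * u + (r + 1) * (z + 1) = r ^ 3 + (r + 1) * r := by
    refine mul_left_cancel₀ hm.ne' ?_
    linear_combination (-1) * h - r ^ 3 * hu
  obtain ⟨v, hv⟩ : r ∣ z + 1 :=
    ⟨r ^ 2 + r + 1 - (x + 1) - r ^ 2 * u - (z + 1), by linear_combination h'⟩
  have hv0 : 0 < v := by
    by_contra hneg
    nlinarith
  have h'' : x + 1 + r ^ 2 * u + (r + 1) * v = r ^ 2 + r + 1 := by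
    refine mul_left_cancel₀ (show r ≠ 0 by omega) ?_
    linear_combination h' - (r + 1) * hv
  nlinarith [mul_le_mul_of_nonneg_left (show 1 ≤ u by omega) (sq_nonneg r)]

/-- The numerical semigroup generated by `r³ - r² + r`, `r³`, `r³ + 1` has
exactly `(r³+1)(r²-2)/2 + 1` gaps (the genus of the GK function field). -/
theorem stmt_10 (r : ℕ) (hr : IsPrimePow r) (hr2 : 2 ≤ r) :
    ((AddSubmonoid.closure
        ({r ^ 3 - r ^ 2 + r, r ^ 3, r ^ 3 + 1} : Set ℕ) : Set ℕ))ᶜ.ncard =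
      (r ^ 3 + 1) * (r ^ 2 - 2) / 2 + 1 := by
  have hrz : (2 : ℤ) ≤ r := by exact_mod_cast hr2
  have hle : r ^ 2 ≤ r ^ 3 := Nat.pow_le_pow_right (by omega) (by omega)
  have hsq : 2 ≤ r ^ 2 := by nlinarith
  obtain ⟨F, hF⟩ : ∃ F : ℕ, (F : ℤ) = r ^ 5 - 2 * r ^ 3 + r ^ 2 - 1 := by
    refine ⟨((r : ℤ) ^ 5 - 2 * r ^ 3 + r ^ 2 - 1).toNat, Int.toNat_of_nonneg ?_⟩
    have h2 : (4 : ℤ) ≤ (r : ℤ) ^ 2 := by nlinarith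
    have h3 : (0 : ℤ) ≤ (r : ℤ) ^ 3 := by positivity
    nlinarith [mul_nonneg h3 (show (0 : ℤ) ≤ (r : ℤ) ^ 2 - 2 by linarith)]
  have hmem : ∀ n : ℕ, n ∈ AddSubmonoid.closure ({r ^ 3 - r ^ 2 + r, r ^ 3, r ^ 3 + 1} : Set ℕ) ↔
      ∃ x y z : ℤ, 0 ≤ x ∧ 0 ≤ y ∧ 0 ≤ z ∧
        (n : ℤ) = ((r : ℤ) ^ 3 - r ^ 2 + r) * x + (r : ℤ) ^ 3 * y + ((r : ℤ) ^ 3 + 1) * z := by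
    intro n
    rw [Nat.mem_closure_triple]
    constructor
    · rintro ⟨x, y, z, h⟩
      refine ⟨x, y, z, by positivity, by positivity, by positivity, ?_⟩
      zify [hle] at h
      exact h
    · rintro ⟨x, y, z, hx, hy, hz, h⟩
      lift x to ℕ using hx
      lift y to ℕ using hy
      lift z to ℕ using hz
      refine ⟨x, y, z, ?_⟩
      zify [hle]
      exact h
  have hgaps := Set.two_mul_ncard_compl_of_symmetric (F := F)
    (S := (AddSubmonoid.closure ({r ^ 3 - r ^ 2 + r, r ^ 3, r ^ 3 + 1} : Set ℕ) : Set ℕ))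
    (by
      intro n hn
      rw [SetLike.mem_coe, SetLike.mem_coe, hmem, hmem, Nat.cast_sub hn]
      constructor
      · rintro ⟨x, y, z, hx, hy, hz, h⟩ ⟨x', y', z', hx', hy', hz', h'⟩
        refine Int.gk_frobenius_ne hrz (add_nonneg hx hx') (add_nonneg hy hy')
          (add_nonneg hz hz') ?_
        linear_combination h + h' - hF
      · intro hnot
        obtain ⟨i, j, k, hj0, hj1, hk0, hk1, h⟩ := Int.exists_gk_normal_form hrz n
        by_cases hi : 0 ≤ i
        · exact ⟨i, j, k, hi, hj0, hk0, h⟩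
        · refine absurd ⟨-1 - i, r ^ 2 - r - j, r - 1 - k, by omega, by omega, by omega, ?_⟩ hnot
          linear_combination hF - h)
    (by
      intro n hn
      rw [SetLike.mem_coe, hmem]
      obtain ⟨i, j, k, hj0, hj1, hk0, hk1, h⟩ := Int.exists_gk_normal_form hrz n
      refine ⟨i, j, k, ?_, hj0, hk0, h⟩
      by_contra hi
      have ha : (0 : ℤ) ≤ (r : ℤ) ^ 3 - r ^ 2 + r := by
        have : (r : ℤ) ^ 2 ≤ (r : ℤ) ^ 3 := by exact_mod_cast hle
        omega
      have hb : (0 : ℤ) ≤ (r : ℤ) ^ 3 := by positivity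
      have hnF : (F : ℤ) < n := by exact_mod_cast hn
      have h1 := mul_nonneg ha (show (0 : ℤ) ≤ -1 - i by omega)
      have h2 := mul_nonneg hb (show (0 : ℤ) ≤ r ^ 2 - r - j by omega)
      have h3 := mul_nonneg (show (0 : ℤ) ≤ (r : ℤ) ^ 3 + 1 by omega)
        (show (0 : ℤ) ≤ r - 1 - k by omega)
      linarith)
  have hgenus : (r ^ 3 + 1) * (r ^ 2 - 2) + 2 = F + 1 := by
    zify [hsq]
    linear_combination -hF
  omega
end

section
/- Let r be a prime power and let L be a finite field with exactly r⁶ elements. Then the number of pairs (x, y) ∈ L × L satisfying y^{r+1} = x^r + x equals r⁶ + r⁵ − r⁴. (This is the point count over F_{r⁶} of the Hermitian curve of genus r(r−1)/2, which is F_{r⁶}-maximal; it underlies the construction of the GK function field as an extension of the Hermitian function field.) -/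
/-- If `f ∘ g` is trivial and the kernels of `g` and `f` have at most `a` and `b` elements, where
`a * b` is the order of the group, then both bounds are attained and `range g = ker f`. -/
@[to_additive]
theorem MonoidHom.exact_of_card_ker_le {G : Type*} [Group G] [Finite G] (g f : G →* G) {a b : ℕ}
    (hfg : ∀ x, f (g x) = 1) (hg : Nat.card g.ker ≤ a) (hf : Nat.card f.ker ≤ b)
    (hG : Nat.card G = a * b) :
    Nat.card g.ker = a ∧ Nat.card f.ker = b ∧ ∀ x, (∃ y, g y = x) ↔ f x = 1 := by
  have hle : g.range ≤ f.ker := by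
    rintro _ ⟨x, rfl⟩
    exact hfg x
  have h1 : Nat.card g.ker * Nat.card g.range = a * b := by
    rw [← Subgroup.index_ker, Subgroup.card_mul_index, hG]
  have h2 : Nat.card g.range ≤ Nat.card f.ker := Subgroup.card_le_of_le hle
  have hpos : 0 < a * b := hG ▸ Nat.card_pos
  have ha : 0 < a := Nat.pos_of_mul_pos_right hpos
  have hb : 0 < b := Nat.pos_of_mul_pos_left hpos
  have h3 : Nat.card g.ker = a := by
    refine le_antisymm hg (Nat.le_of_mul_le_mul_right ?_ hb)
    rw [← h1]
    exact Nat.mul_le_mul_left _ (h2.trans hf)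
  have h4 : Nat.card g.range = b := by
    rw [h3] at h1
    exact Nat.eq_of_mul_eq_mul_left ha h1
  have h5 : Nat.card f.ker = b := le_antisymm hf (h4 ▸ h2)
  have h6 : g.range = f.ker := Subgroup.eq_of_le_of_card_ge hle (by rw [h4, h5])
  refine ⟨h3, h5, fun x => ?_⟩
  rw [← MonoidHom.mem_range, h6, MonoidHom.mem_ker]

/-- The number of solutions of `f x = h y` is the order of `ker f` times the number of `y` for
which a solution exists. -/
theorem AddMonoidHom.card_eq_apply {G Y : Type*} [AddGroup G] (f : G →+ G) (h : Y → G) :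
    Nat.card {p : G × Y // f p.1 = h p.2} =
      Nat.card f.ker * Nat.card {y // ∃ x, f x = h y} := by
  rw [← Nat.card_prod]
  choose s hs using fun y : {y // ∃ x, f x = h y} => y.2
  refine Nat.card_congr ⟨fun p => (⟨p.1.1 - s ⟨p.1.2, p.1.1, p.2⟩, ?_⟩, ⟨p.1.2, p.1.1, p.2⟩),
    fun p => ⟨(p.1 + s p.2, p.2.1), ?_⟩, fun p => ?_, fun p => ?_⟩
  · rw [AddMonoidHom.mem_ker, map_sub, hs, p.2, sub_self]
  · have := p.1.2
    rw [AddMonoidHom.mem_ker] at this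
    rw [map_add, hs, this, zero_add]
  · simp
  · ext <;> simp

/-- A monic `r`-linearized polynomial of degree `r ^ k` has at most `r ^ k` roots. -/
theorem card_linearized_roots_le {L : Type*} [Field L] {r : ℕ} (hr : 1 < r) {k : ℕ}
    (a : Fin k → L) :
    Nat.card {x : L // x ^ r ^ k + ∑ i, a i * x ^ r ^ (i : ℕ) = 0} ≤ r ^ k := by
  classical
  open Polynomial in
  set Q : L[X] := ∑ i, C (a i) * X ^ r ^ (i : ℕ) with hQ
  have hdeg : Q.degree < (r ^ k : ℕ) := by
    refine (Polynomial.degree_sum_le _ _).trans_lt ?_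
    rw [Finset.sup_lt_iff (WithBot.bot_lt_coe _)]
    intro i _
    refine (Polynomial.degree_C_mul_X_pow_le _ _).trans_lt ?_
    exact_mod_cast Nat.pow_lt_pow_right hr i.2
  have hmonic := Polynomial.monic_X_pow_add hdeg
  have hnat : (Polynomial.X ^ r ^ k + Q).natDegree = r ^ k := by
    refine Polynomial.natDegree_eq_of_degree_eq_some ?_
    rw [Polynomial.degree_add_eq_left_of_degree_lt (by rwa [Polynomial.degree_X_pow]),
      Polynomial.degree_X_pow]
  calc _ = Nat.card {x : L // x ∈ (Polynomial.X ^ r ^ k + Q).roots.toFinset} := by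
        refine Nat.card_congr (Equiv.subtypeEquivRight fun x => ?_)
        rw [Multiset.mem_toFinset, Polynomial.mem_roots hmonic.ne_zero]
        simp [hQ, Polynomial.eval_finsetSum]
    _ = (Polynomial.X ^ r ^ k + Q).roots.toFinset.card := Nat.card_eq_finsetCard _
    _ ≤ _ := (Multiset.toFinset_card_le _).trans ((Polynomial.card_roots' _).trans hnat.le)

/-- In a finite field with `r ^ m` elements, `m ≠ 0`, the map `x ↦ x ^ r` is a ring
homomorphism. -/
theorem exists_ringHom_pow {r m : ℕ} (hr : IsPrimePow r) (hm : m ≠ 0) (L : Type*) [Field L]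
    [Fintype L] (hL : Fintype.card L = r ^ m) : ∃ F : L →+* L, ∀ x, F x = x ^ r := by
  obtain ⟨p, n, hp, hn, rfl⟩ := hr
  obtain ⟨p', hc⟩ := CharP.exists L
  obtain ⟨k, hp', hk⟩ := FiniteField.card L p'
  have : p = p' := by
    have h : p ∣ p' ^ (k : ℕ) := by
      rw [← hk, hL, ← pow_mul]
      exact dvd_pow_self _ (by positivity)
    exact (Nat.prime_dvd_prime_iff_eq hp.nat_prime hp').1 (hp.nat_prime.dvd_of_dvd_pow h)
  subst this
  have := Fact.mk hp'
  exact ⟨iterateFrobenius L p n, fun x => iterateFrobenius_def p n x⟩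

section SexticExtension

variable {L : Type*} [Field L] {r : ℕ} {F : L →+* L}

theorem pow_pow_eq_iterate (hF : ∀ x, F x = x ^ r) (k : ℕ) (x : L) : x ^ r ^ k = F^[k] x := by
  induction k with
  | zero => simp
  | succ k ih => rw [pow_succ, pow_mul, ih, ← hF, Function.iterate_succ_apply']

theorem card_ker_le (hr : 1 < r) (hF : ∀ x, F x = x ^ r) {k : ℕ} (a : Fin k → L) (g : L →+ L)
    (hg : ∀ x, g x = F^[k] x + ∑ i, a i * F^[(i : ℕ)] x) : Nat.card g.ker ≤ r ^ k := by
  refine le_trans (le_of_eq ?_) (card_linearized_roots_le hr a)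
  refine Nat.card_congr (Equiv.subtypeEquivRight fun x => ?_)
  simp only [AddMonoidHom.mem_ker, hg, pow_pow_eq_iterate hF]

variable [Finite L]

theorem iterate_six (hF : ∀ x, F x = x ^ r) (hL : Nat.card L = r ^ 6) (x : L) :
    F (F (F (F (F (F x))))) = x := by
  have := Fintype.ofFinite L
  have h := pow_pow_eq_iterate hF 6 x
  rw [← hL, Nat.card_eq_fintype_card, FiniteField.pow_card] at h
  exact h.symm

theorem pow_add_self_exact (hr : 1 < r) (hF : ∀ x, F x = x ^ r) (hL : Nat.card L = r ^ 6)
    (g : L →+ L) (hg : ∀ x, g x = F x + x) :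
    Nat.card g.ker = r ∧ ∀ x, (∃ y, g y = x) ↔
      x - F x + F (F x) - F (F (F x)) + F (F (F (F x))) - F (F (F (F (F x)))) = 0 := by
  let f : L →+ L := AddMonoidHom.mk' (fun x => F (F (F (F (F x)))) - F (F (F (F x)))
    + F (F (F x)) - F (F x) + F x - x) (fun x y => by simp only [map_add]; ring)
  have hf (x) : f x = F (F (F (F (F x)))) - F (F (F (F x))) + F (F (F x)) - F (F x) + F x - x :=
    rfl
  obtain ⟨h1, -, h2⟩ := AddMonoidHom.exact_of_card_ker_le g f (a := r ^ 1) (b := r ^ 5)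
    (fun x => by simp only [hf, hg, map_add, iterate_six hF hL]; ring)
    (card_ker_le hr hF ![1] g fun x => by simp [hg])
    (card_ker_le hr hF ![-1, 1, -1, 1, -1] f fun x => by simp [hf, Fin.sum_univ_succ]; ring)
    (by rw [hL]; ring)
  refine ⟨by simpa using h1, fun x => (h2 x).trans ?_⟩
  rw [hf, ← neg_eq_zero]
  ring_nf

theorem sq_sub_self_exact (hr : 1 < r) (hF : ∀ x, F x = x ^ r) (hL : Nat.card L = r ^ 6)
    (g : L →+ L) (hg : ∀ x, g x = F (F x) - x) :
    Nat.card g.ker = r ^ 2 ∧ ∀ x, (∃ y, g y = x) ↔ x + F (F x) + F (F (F (F x))) = 0 := by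
  let f : L →+ L := AddMonoidHom.mk' (fun x => x + F (F x) + F (F (F (F x))))
    (fun x y => by simp only [map_add]; ring)
  have hf (x) : f x = x + F (F x) + F (F (F (F x))) := rfl
  obtain ⟨h1, -, h2⟩ := AddMonoidHom.exact_of_card_ker_le g f (a := r ^ 2) (b := r ^ 4)
    (fun x => by simp only [hf, hg, map_sub, iterate_six hF hL]; ring)
    (card_ker_le hr hF ![-1, 0] g fun x => by simp [hg, Fin.sum_univ_succ]; ring)
    (card_ker_le hr hF ![1, 0, 1, 0] f fun x => by simp [hf, Fin.sum_univ_succ]; ring)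
    (by rw [hL]; ring)
  exact ⟨h1, h2⟩

theorem card_trace_zero (hr : 1 < r) (hF : ∀ x, F x = x ^ r) (hL : Nat.card L = r ^ 6) :
    Nat.card {d : L // d + F d + F (F d) = 0} = r ^ 2 := by
  let g : L →+ L := AddMonoidHom.mk' (fun x => x + F x + F (F x))
    (fun x y => by simp only [map_add]; ring)
  let f : L →+ L := AddMonoidHom.mk' (fun x => F (F (F (F x))) - F (F (F x)) + F x - x)
    (fun x y => by simp only [map_add]; ring)
  have hg (x) : g x = x + F x + F (F x) := rfl
  have hf (x) : f x = F (F (F (F x))) - F (F (F x)) + F x - x := rfl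
  exact (AddMonoidHom.exact_of_card_ker_le g f (a := r ^ 2) (b := r ^ 4)
    (fun x => by simp only [hf, hg, map_add, iterate_six hF hL]; ring)
    (card_ker_le hr hF ![1, 1] g fun x => by simp [hg, Fin.sum_univ_succ]; ring)
    (card_ker_le hr hF ![-1, 1, 0, -1] f fun x => by simp [hf, Fin.sum_univ_succ]; ring)
    (by rw [hL]; ring)).1

/-- There are `r + 1` elements `v` of relative norm one, and each is of the form `c ^ (r - 1)`
with `c` in the subfield of order `r ^ 2`. -/
theorem norm_one_units (hr : 1 < r) (hF : ∀ x, F x = x ^ r) (hL : Nat.card L = r ^ 6) :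
    Nat.card {v : L // v * F v = 1} = r + 1 ∧
      ∀ v : L, v * F v = 1 → ∃ c : L, c ≠ 0 ∧ F c = v * c := by
  have := Fintype.ofFinite L
  obtain ⟨m, rfl⟩ : ∃ m, r = m + 1 := ⟨r - 1, by omega⟩
  have hm : 0 < m := by omega
  set n := (m + 1) ^ 4 + (m + 1) ^ 2 + 1 with hn
  have hle (k : ℕ) (hk : 0 < k) : Nat.card (powMonoidHom k : Lˣ →* Lˣ).ker ≤ k := by
    classical
    refine le_trans (le_of_eq ?_) (IsCyclic.card_pow_eq_one_le (α := Lˣ) hk)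
    rw [← Fintype.card_subtype, ← Nat.card_eq_fintype_card]
    exact Nat.card_congr (Equiv.subtypeEquivRight fun x => by simp [MonoidHom.mem_ker])
  have hcard : Nat.card Lˣ = (m * n) * (m + 2) := by
    rw [Nat.card_units, hL, Nat.sub_eq_iff_eq_add (Nat.one_le_pow _ _ (by omega)), hn]
    ring
  obtain ⟨-, h1, h2⟩ := MonoidHom.exact_of_card_ker_le (powMonoidHom (m * n) : Lˣ →* Lˣ)
    (powMonoidHom (m + 2)) (a := m * n) (b := m + 2)
    (fun x => by simp only [powMonoidHom_apply]; rw [← pow_mul, ← hcard, pow_card_eq_one'])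
    (hle _ (by positivity)) (hle _ (by positivity)) hcard
  refine ⟨?_, fun v hv => ?_⟩
  · refine Eq.trans (Nat.card_congr ?_) h1
    refine ⟨fun v => ⟨Units.mkOfMulEqOne v.1 _ v.2, ?_⟩, fun v => ⟨v.1, ?_⟩, fun v => ?_,
      fun v => ?_⟩
    · rw [MonoidHom.mem_ker, powMonoidHom_apply, Units.ext_iff]
      simpa [hF, ← pow_succ'] using v.2
    · have := v.2
      rw [MonoidHom.mem_ker, powMonoidHom_apply, Units.ext_iff] at this
      simpa [hF, ← pow_succ'] using this
    · rfl
    · ext; rfl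
  · obtain ⟨c, hc⟩ := (h2 (Units.mkOfMulEqOne v _ hv)).2 (by
      rw [powMonoidHom_apply, Units.ext_iff]
      simpa [hF, ← pow_succ'] using hv)
    refine ⟨(c : L) ^ n, by simp, ?_⟩
    rw [powMonoidHom_apply, Units.ext_iff] at hc
    simp only [Units.val_pow_eq_pow_val, Units.val_mkOfMulEqOne] at hc
    rw [hF, ← hc]
    ring

/-- The nonzero `u` of trace zero over the subfield of order `r ^ 2` with
`u ^ (r + 1)` fixed by `x ↦ x ^ r ^ 3`. -/
theorem card_ne_zero_isotropic (hr : 1 < r) (hF : ∀ x, F x = x ^ r) (hL : Nat.card L = r ^ 6) :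
    Nat.card {u : L // (u + F (F u) + F (F (F (F u))) = 0 ∧
      u * F u = F (F (F u)) * F (F (F (F u)))) ∧ u ≠ 0} = (r + 1) * (r ^ 2 - 1) := by
  obtain ⟨hcard, hc⟩ := norm_one_units hr hF hL
  have hD : Nat.card {d : L // d + F d + F (F d) = 0 ∧ d ≠ 0} = r ^ 2 - 1 := by
    have := Set.ncard_sdiff_singleton_of_mem (s := {d : L | d + F d + F (F d) = 0}) (a := 0)
      (by simp)
    rw [← Nat.card_coe_set_eq, ← Nat.card_coe_set_eq] at this
    exact this.trans (congrArg (· - 1) (card_trace_zero hr hF hL))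
  have hfix (v c : L) (hv : v * F v = 1) (h : F c = v * c) : F (F c) = c := by
    rw [h, map_mul, h]
    linear_combination c * hv
  have hD3 (d : L) (h : d + F d + F (F d) = 0) : F (F (F d)) = d := by
    have h' := congrArg F h
    simp only [map_add, map_zero] at h'
    linear_combination h' - h
  choose c hc0 hcv using fun v : {v : L // v * F v = 1} => hc v v.2
  have hcc (v) : F (F (c v)) = c v := hfix v.1 _ v.2 (hcv v)
  rw [← hcard, ← hD, ← Nat.card_prod]
  refine (Nat.card_congr (Equiv.ofBijective
    (fun p => ⟨c p.1 * p.2.1, ⟨?trace, ?norm⟩, ?ne⟩) ⟨?inj, ?surj⟩)).symm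
  case trace =>
    simp only [map_mul, hcc, hD3 _ p.2.2.1]
    linear_combination c p.1 * p.2.2.1
  case norm =>
    simp only [map_mul, hcc, hD3 _ p.2.2.1]
    ring
  case ne => exact mul_ne_zero (hc0 _) p.2.2.2
  case inj =>
    rintro ⟨v, d, hd, hd0⟩ ⟨w, e, he, he0⟩ h
    have h : c v * d = c w * e := congrArg Subtype.val h
    have h3 := congrArg (fun x => F (F (F x))) h
    simp only [map_mul, hcc, hD3 _ hd, hD3 _ he] at h3
    rw [hcv, hcv] at h3
    have hvw : v = w := by
      refine Subtype.ext (mul_right_cancel₀ (mul_ne_zero (hc0 v) hd0) ?_)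
      linear_combination h3 - w.1 * h
    subst hvw
    have := mul_left_cancel₀ (hc0 v) h
    subst this
    rfl
  case surj =>
    rintro ⟨u, ⟨h1, h2⟩, hu⟩
    have hFu : F u ≠ 0 := by simpa using hu
    have hv : (F (F (F u)) / u) * F (F (F (F u)) / u) = 1 := by
      rw [map_div₀]
      field_simp
      exact h2.symm
    set v : {v : L // v * F v = 1} := ⟨_, hv⟩ with hvdef
    have hv3 : F (F (F u)) = v.1 * u := by
      rw [hvdef]
      field_simp
    have hd3 : F (F (F (u / c v))) = u / c v := by
      simp only [map_div₀, hcc]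
      rw [hv3, hcv]
      have : v.1 ≠ 0 := left_ne_zero_of_mul_eq_one v.2
      have := hc0 v
      field_simp
    have ht : u / c v + F (u / c v) + F (F (u / c v)) = 0 := by
      have : u / c v + F (F (u / c v)) + F (F (F (F (u / c v)))) = 0 := by
        simp only [map_div₀, hcc]
        rw [← add_div, ← add_div, h1, zero_div]
      rw [hd3] at this
      linear_combination this
    exact ⟨(v, ⟨u / c v, ht, div_ne_zero hu (hc0 v)⟩), Subtype.ext (mul_div_cancel₀ _ (hc0 v))⟩

theorem card_isotropic (hr : 1 < r) (hF : ∀ x, F x = x ^ r) (hL : Nat.card L = r ^ 6) :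
    Nat.card {u : L // u + F (F u) + F (F (F (F u))) = 0 ∧
      u * F u = F (F (F u)) * F (F (F (F u)))} = (r + 1) * (r ^ 2 - 1) + 1 := by
  have := Set.ncard_sdiff_singleton_add_one (s := {u : L | u + F (F u) + F (F (F (F u))) = 0 ∧
      u * F u = F (F (F u)) * F (F (F (F u)))}) (a := 0) (by simp)
  rw [← Nat.card_coe_set_eq, ← Nat.card_coe_set_eq] at this
  exact this.symm.trans (congrArg (· + 1) (card_ne_zero_isotropic hr hF hL))

theorem card_alternating_sum_eq_zero (hr : 1 < r) (hF : ∀ x, F x = x ^ r)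
    (hL : Nat.card L = r ^ 6) (S : L → L)
    (hS : ∀ x, S x = x - F x + F (F x) - F (F (F x)) + F (F (F (F x))) - F (F (F (F (F x))))) :
    Nat.card {y : L // S (y * F y) = 0} = r ^ 2 * ((r + 1) * (r ^ 2 - 1) + 1) := by
  let g : L →+ L := AddMonoidHom.mk' (fun x => F (F x) - x)
    (fun x y => by simp only [map_add]; ring)
  have hg (x) : g x = F (F x) - x := rfl
  obtain ⟨h1, h2⟩ := sq_sub_self_exact hr hF hL g hg
  have hSy (y : L) : S (y * F y) = 0 ↔ g y * F (g y) = F (F (F (g y))) * F (F (F (F (g y)))) := by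
    rw [← sub_eq_zero (a := g y * F (g y)), hS]
    simp only [hg, map_mul, map_sub, iterate_six hF hL]
    ring_nf
  have h := g.card_eq_apply
    (fun u : {u : L // u * F u = F (F (F u)) * F (F (F (F u)))} => u.1)
  rw [h1] at h
  rw [← card_isotropic hr hF hL]
  refine Eq.trans (Nat.card_congr ?_) (h.trans (congrArg _ (Nat.card_congr ?_)))
  · exact ⟨fun y => ⟨(y.1, ⟨g y.1, (hSy _).1 y.2⟩), rfl⟩,
      fun p => ⟨p.1.1, (hSy _).2 (by rw [p.2]; exact p.1.2.2)⟩, fun y => rfl,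
      fun p => Subtype.ext (Prod.ext rfl (Subtype.ext p.2))⟩
  · exact ⟨fun u => ⟨u.1.1, (h2 _).1 u.2, u.1.2⟩, fun u => ⟨⟨u.1, u.2.2⟩, (h2 _).2 u.2.1⟩,
      fun u => rfl, fun u => rfl⟩

end SexticExtension

/-- Point count of the Hermitian curve `y^{r+1} = x^r + x` over a field with
`r^6` elements: there are exactly `r^6 + r^5 - r^4` affine points. -/
theorem stmt_12 (r : ℕ) (hr : IsPrimePow r)
    (L : Type*) [Field L] [Fintype L] (hL : Fintype.card L = r ^ 6) :
    Nat.card {p : L × L // p.2 ^ (r + 1) = p.1 ^ r + p.1} =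
      r ^ 6 + r ^ 5 - r ^ 4 := by
  obtain ⟨F, hF⟩ := exists_ringHom_pow hr (by norm_num) L hL
  have hr1 := hr.one_lt
  rw [← Nat.card_eq_fintype_card] at hL
  let g : L →+ L := AddMonoidHom.mk' (fun x => F x + x)
    (fun x y => by simp only [map_add]; ring)
  obtain ⟨h1, h2⟩ := pow_add_self_exact hr1 hF hL g fun _ => rfl
  have h := g.card_eq_apply fun y : L => y * F y
  simp only [h2] at h
  rw [h1, card_alternating_sum_eq_zero hr1 hF hL _ fun _ => rfl] at h
  have hpt : Nat.card {p : L × L // p.2 ^ (r + 1) = p.1 ^ r + p.1} =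
      Nat.card {p : L × L // g p.1 = p.2 * F p.2} := by
    refine Nat.card_congr (Equiv.subtypeEquivRight fun p => ?_)
    rw [show g p.1 = F p.1 + p.1 from rfl, hF, hF, ← pow_succ', eq_comm]
  rw [hpt, h]
  obtain ⟨m, rfl⟩ : ∃ m, r = m + 1 := ⟨r - 1, by omega⟩
  have e : (m + 1) ^ 2 - 1 = m ^ 2 + 2 * m := by
    rw [Nat.sub_eq_iff_eq_add (Nat.one_le_pow _ _ (by omega))]
    ring
  rw [e]
  symm
  rw [Nat.sub_eq_iff_eq_add
    ((Nat.pow_le_pow_right (by omega) (by norm_num)).trans (Nat.le_add_right _ _))]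
  ring
end

section
/- Let K be a field and let m be a positive integer not divisible by the characteristic of K. Then the polynomial X^m + Y^m + 1 is irreducible in the polynomial ring K[X, Y]. (This underlies the fact that the equation y^m + x^m + 1 = 0 defines a function field F = K(x,y) with K algebraically closed in F, coming from a non-singular plane curve of degree m.) -/
open MvPolynomial

/-- Eisenstein's criterion at a prime dividing `a` exactly once, for `X ^ m + a`. -/
theorem Polynomial.irreducible_X_pow_add_C_of_prime_dvd {A : Type*} [CommRing A] [IsDomain A]
    {m : ℕ} (hm : 0 < m) {a p : A} (hp : Prime p) (hpa : p ∣ a) (hpa2 : ¬ p ^ 2 ∣ a) :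
    Irreducible (Polynomial.X ^ m + Polynomial.C a : Polynomial A) := by
  have hmonic := Polynomial.monic_X_pow_add_C a hm.ne'
  refine Polynomial.irreducible_of_eisenstein_criterion (P := Ideal.span {p})
    ((Ideal.span_singleton_prime hp.ne_zero).2 hp) ?_ ?_ ?_ ?_ hmonic.isPrimitive
  · rw [hmonic.leadingCoeff, Ideal.mem_span_singleton]
    exact fun h => hp.not_isUnit (isUnit_of_dvd_one h)
  · intro n hn
    rw [Polynomial.degree_X_pow_add_C hm, Nat.cast_lt] at hn
    rw [Polynomial.coeff_add, Polynomial.coeff_X_pow, if_neg hn.ne, zero_add,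
      Polynomial.coeff_C, Ideal.mem_span_singleton]
    split_ifs
    · exact hpa
    · exact dvd_zero p
  · rw [Polynomial.degree_X_pow_add_C hm]
    exact_mod_cast hm
  · rw [Ideal.span_singleton_pow, Ideal.mem_span_singleton]
    simpa [hm.ne] using hpa2

/-- The polynomial `Y ^ m + (X ^ m + 1)` is irreducible in `K[X][Y]` when `m ≠ 0` in `K`. -/
theorem Polynomial.irreducible_X_pow_add_C_X_pow_add_one {K : Type*} [Field K] {m : ℕ}
    (hm : (m : K) ≠ 0) :
    Irreducible (Polynomial.X ^ m + Polynomial.C (Polynomial.X ^ m + 1) :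
      Polynomial (Polynomial K)) := by
  have hm' : 0 < m := Nat.pos_of_ne_zero fun h => hm (by simp [h])
  have hsep : (Polynomial.X ^ m + 1 : Polynomial K).Separable := by
    simpa using Polynomial.separable_X_pow_sub_C (-1 : K) hm (by simp)
  have hdeg : (Polynomial.X ^ m + 1 : Polynomial K).degree = m := by
    simpa using Polynomial.degree_X_pow_add_C hm' (1 : K)
  obtain ⟨p, hp, hpa⟩ := WfDvdMonoid.exists_irreducible_factor
    (Polynomial.not_isUnit_of_degree_pos _ (by rw [hdeg]; exact_mod_cast hm'))
    hsep.squarefree.ne_zero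
  refine Polynomial.irreducible_X_pow_add_C_of_prime_dvd hm' hp.prime hpa fun h => ?_
  exact hp.not_isUnit (hsep.squarefree p (by rwa [← sq]))

/-- For a field `K` and `m ≥ 1` not divisible by the characteristic of `K`,
the polynomial `X^m + Y^m + 1` is irreducible in `K[X, Y]`. -/
theorem stmt_13 (K : Type*) [Field K] (m : ℕ) (hm : 0 < m)
    (hchar : ¬ (ringChar K ∣ m)) :
    Irreducible ((X 0) ^ m + (X 1) ^ m + 1 : MvPolynomial (Fin 2) K) := by
  have h1 : finSuccEquiv K 1 (X 1) = Polynomial.C (X 0) := by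
    rw [← finSuccEquiv_X_succ, Fin.succ_zero_eq_one]
  rw [← MulEquiv.irreducible_iff (finSuccEquiv K 1),
    ← MulEquiv.irreducible_iff (Polynomial.mapEquiv (uniqueAlgEquiv K (Fin 1)).toRingEquiv)]
  have h := Polynomial.irreducible_X_pow_add_C_X_pow_add_one (mt (ringChar.spec K m).1 hchar)
  simpa [finSuccEquiv_X_zero, h1, add_assoc] using h
end

section
/- Let q be a prime power with q ≡ 2 (mod 3), let K be a finite field with exactly q² elements, let m = (q+1)/3, and let w ∈ K satisfy w^m = 3. Then the ideal of the polynomial ring K[X, Y, Z] generated by the two polynomials X^m + Y^m + 1 and Z³ − w·X·Y is a prime ideal. (This is the statement that the Kummer extension F̄ = F(z) with z³ = wxy of the Fermat-type function field F = K(x,y), y^m + x^m + 1 = 0, is a function field over K, i.e., that wxy is not a cube in F and the resulting curve is irreducible over K.) -/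
open MvPolynomial

section Helpers

open Polynomial

/-- Eisenstein's criterion for `X ^ n + a`. -/
theorem irreducible_X_pow_add_C_of_not_sq_dvd {R : Type*} [CommRing R] [IsDomain R] {p a : R}
    (hp : Prime p) (h₁ : p ∣ a) (h₂ : ¬ p ^ 2 ∣ a) {n : ℕ} (hn : n ≠ 0) :
    Irreducible (Polynomial.X ^ n + Polynomial.C a : R[X]) := by
  have hmonic : (Polynomial.X ^ n + Polynomial.C a : R[X]).Monic := monic_X_pow_add_C a hn
  refine irreducible_of_eisenstein_criterion (P := Ideal.span {p})
    ((Ideal.span_singleton_prime hp.ne_zero).2 hp) ?_ ?_ ?_ ?_ hmonic.isPrimitive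
  · rw [hmonic.leadingCoeff, Ideal.mem_span_singleton]
    exact fun h => hp.not_isUnit (isUnit_of_dvd_one h)
  · intro k hk
    rw [degree_X_pow_add_C (Nat.pos_of_ne_zero hn), Nat.cast_lt] at hk
    rw [Polynomial.coeff_add, Polynomial.coeff_X_pow, if_neg hk.ne, zero_add,
      Polynomial.coeff_C, Ideal.mem_span_singleton]
    split_ifs
    exacts [h₁, dvd_zero p]
  · rw [degree_X_pow_add_C (Nat.pos_of_ne_zero hn)]
    exact_mod_cast Nat.pos_of_ne_zero hn
  · simpa [Ideal.span_singleton_pow, Ideal.mem_span_singleton, Polynomial.coeff_X_pow, hn.symm]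
      using h₂

/-- An element of an integrally closed domain that is exactly divisible by a prime is not a
proper power in the fraction field. -/
theorem pow_ne_algebraMap_of_not_sq_dvd {R : Type*} [CommRing R] [IsDomain R]
    [IsIntegrallyClosed R] {k : Type*} [Field k] [Algebra R k] [IsFractionRing R k] {p d : R}
    (hp : Prime p) (h₁ : p ∣ d) (h₂ : ¬ p ^ 2 ∣ d) {n : ℕ} (hn : 2 ≤ n) (x : k) :
    x ^ n ≠ algebraMap R k d := by
  intro hx
  obtain ⟨y, rfl⟩ := IsIntegrallyClosed.exists_algebraMap_eq_of_isIntegral_pow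
    (R := R) (show 0 < n by omega) (hx ▸ isIntegral_algebraMap)
  rw [← map_pow] at hx
  obtain rfl := IsFractionRing.injective R k hx
  exact h₂ ((pow_dvd_pow_of_dvd (hp.dvd_of_dvd_pow h₁) 2).trans (pow_dvd_pow y hn))

/-- If `a` is exactly divisible by a prime not dividing `b`, then `b` times an `n`-th root of `-a`
is not a proper power, since its norm `± b ^ n * a` is not. -/
theorem pow_ne_algebraMap_mul_root {R : Type*} [CommRing R] [IsDomain R]
    [IsIntegrallyClosed R] {k : Type*} [Field k] [Algebra R k] [IsFractionRing R k] {p a b : R}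
    (hp : Prime p) (h₁ : p ∣ a) (h₂ : ¬ p ^ 2 ∣ a) (hb : ¬ p ∣ b) {n : ℕ} (hn : n ≠ 0)
    {l : ℕ} (hl : 2 ≤ l)
    (x : AdjoinRoot (Polynomial.X ^ n + Polynomial.C (algebraMap R k a))) :
    x ^ l ≠ AdjoinRoot.of _ (algebraMap R k b) * AdjoinRoot.root _ := by
  intro hx
  have hmonic : (Polynomial.X ^ n + Polynomial.C (algebraMap R k a)).Monic :=
    monic_X_pow_add_C _ hn
  let pb := AdjoinRoot.powerBasis hmonic.ne_zero
  have hdim : pb.dim = n := by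
    rw [AdjoinRoot.powerBasis_dim, natDegree_X_pow_add_C]
  have hgen : Algebra.norm k pb.gen = (-1) ^ n * algebraMap R k a := by
    rw [Algebra.PowerBasis.norm_gen_eq_coeff_zero_minpoly, hdim,
      AdjoinRoot.minpoly_powerBasis_gen_of_monic hmonic]
    simp [Polynomial.coeff_X_pow, hn.symm]
  have hnorm := congrArg (Algebra.norm k) hx
  rw [map_pow, map_mul, ← AdjoinRoot.algebraMap_eq, Algebra.norm_algebraMap,
    ← AdjoinRoot.powerBasis_gen hmonic.ne_zero, hgen, pb.finrank, hdim] at hnorm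
  refine pow_ne_algebraMap_of_not_sq_dvd (d := (-1) ^ n * b ^ n * a) hp (h₁.mul_left _) ?_ hl _
    (hnorm.trans (by simp only [map_mul, map_pow, map_neg, map_one]; ring))
  have hu : ¬ p ∣ (-1) ^ n * b ^ n := fun h => by
    rcases hp.dvd_or_dvd h with h | h
    · exact hp.not_isUnit (isUnit_of_dvd_unit h (isUnit_one.neg.pow n))
    · exact hb (hp.dvd_of_dvd_pow h)
  exact fun h => h₂ (hp.pow_dvd_of_dvd_mul_left 2 hu h)

/-- A monic polynomial that becomes irreducible over a field `L`, together with a generator of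
the kernel of `T → L`, generates a prime ideal of `T[X]`. -/
theorem isPrime_span_C_monic {T L : Type*} [CommRing T] [Field L] (φ : T →+* L) {f : T}
    (hf : RingHom.ker φ = Ideal.span {f}) {g : T[X]} (hg : g.Monic)
    (hirr : Irreducible (g.map φ)) :
    (Ideal.span {Polynomial.C f, g} : Ideal T[X]).IsPrime := by
  have : Fact (Irreducible (g.map φ)) := ⟨hirr⟩
  have hker : Ideal.span {Polynomial.C f, g} =
      RingHom.ker ((AdjoinRoot.mk (g.map φ)).comp (mapRingHom φ)) := by
    apply le_antisymm
    · rw [Ideal.span_le]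
      rintro x (rfl | rfl)
      · have : φ f = 0 := by
          rw [← RingHom.mem_ker, hf]
          exact Ideal.mem_span_singleton_self f
        simp [RingHom.mem_ker, this]
      · simp [RingHom.mem_ker]
    · intro x hx
      rw [RingHom.mem_ker, RingHom.comp_apply, AdjoinRoot.mk_eq_zero, coe_mapRingHom,
        ← modByMonic_eq_zero_iff_dvd (hg.map φ), ← map_modByMonic φ hg] at hx
      have hdvd : Polynomial.C f ∣ x %ₘ g := by
        rw [Polynomial.C_dvd_iff_dvd_coeff]
        intro i
        rw [← Ideal.mem_span_singleton, ← hf, RingHom.mem_ker, ← Polynomial.coeff_map, hx,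
          Polynomial.coeff_zero]
      rw [← modByMonic_add_div x g]
      exact Ideal.add_mem _
        (Ideal.mem_of_dvd _ hdvd (Ideal.subset_span (Set.mem_insert _ _)))
        (Ideal.mul_mem_right _ _ (Ideal.subset_span (Set.mem_insert_of_mem _ rfl)))
  rw [hker]
  exact RingHom.ker_isPrime _

/-- The ideal `(Y ^ n + a, Z ^ l - b Y)` of `R[Y][Z]` is prime when `l` is prime and `a` is exactly
divisible by a prime element not dividing `b`. -/
theorem isPrime_span_X_pow_add_C_X_pow_sub_C {R : Type*} [CommRing R] [IsDomain R]
    [IsIntegrallyClosed R] {p a b : R} (hp : Prime p) (h₁ : p ∣ a) (h₂ : ¬ p ^ 2 ∣ a)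
    (hb : ¬ p ∣ b) {n : ℕ} (hn : n ≠ 0) {l : ℕ} (hl : l.Prime) :
    (Ideal.span {Polynomial.C (Polynomial.X ^ n + Polynomial.C a),
      Polynomial.X ^ l - Polynomial.C (Polynomial.C b * Polynomial.X)} : Ideal R[X][X]).IsPrime := by
  let k := FractionRing R
  have hmonic : (Polynomial.X ^ n + Polynomial.C a : R[X]).Monic := monic_X_pow_add_C a hn
  have hmap : (Polynomial.X ^ n + Polynomial.C a : R[X]).map (algebraMap R k) =
      Polynomial.X ^ n + Polynomial.C (algebraMap R k a) := by simp
  have hirr : Irreducible (Polynomial.X ^ n + Polynomial.C (algebraMap R k a)) := by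
    rw [← hmap, ← hmonic.irreducible_iff_irreducible_map_fraction_map]
    exact irreducible_X_pow_add_C_of_not_sq_dvd hp h₁ h₂ hn
  have : Fact (Irreducible (Polynomial.X ^ n + Polynomial.C (algebraMap R k a))) := ⟨hirr⟩
  let φ : R[X] →+* AdjoinRoot (Polynomial.X ^ n + Polynomial.C (algebraMap R k a)) :=
    (AdjoinRoot.mk _).comp (mapRingHom (algebraMap R k))
  refine isPrime_span_C_monic φ ?_ (monic_X_pow_sub_C _ hl.ne_zero) ?_
  · ext x
    rw [RingHom.mem_ker, Ideal.mem_span_singleton, RingHom.comp_apply, AdjoinRoot.mk_eq_zero,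
      coe_mapRingHom, ← hmap, map_dvd_map _ (IsFractionRing.injective R k) hmonic]
  · rw [Polynomial.map_sub, Polynomial.map_pow, Polynomial.map_X, Polynomial.map_C]
    refine X_pow_sub_C_irreducible_of_prime hl fun x hx =>
      pow_ne_algebraMap_mul_root hp h₁ h₂ hb hn hl.two_le x (hx.trans ?_)
    simp [φ]

/-- A prime factor of `X ^ n + 1` divides it exactly once and does not divide `c * X`. -/
theorem exists_prime_dvd_X_pow_add_one {K : Type*} [Field K] {n : ℕ} (hn : (n : K) ≠ 0)
    {c : K} (hc : c ≠ 0) :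
    ∃ p : K[X], Prime p ∧ p ∣ Polynomial.X ^ n + 1 ∧ ¬ p ^ 2 ∣ Polynomial.X ^ n + 1 ∧
      ¬ p ∣ Polynomial.C c * Polynomial.X := by
  have hn₀ : n ≠ 0 := by
    rintro rfl
    simp at hn
  have hdeg : (Polynomial.X ^ n + 1 : K[X]).natDegree = n := by
    simpa using natDegree_X_pow_add_C (n := n) (r := (1 : K))
  have hunit : ¬ IsUnit (Polynomial.X ^ n + 1 : K[X]) := fun h =>
    hn₀ (hdeg ▸ natDegree_eq_zero_of_isUnit h)
  have hne : (Polynomial.X ^ n + 1 : K[X]) ≠ 0 := fun h => by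
    rw [h, natDegree_zero] at hdeg
    exact hn₀ hdeg.symm
  have hsq : Squarefree (Polynomial.X ^ n + 1 : K[X]) := by
    simpa using (separable_X_pow_sub_C (-1 : K) hn (by simp)).squarefree
  obtain ⟨p, hp, hdvd⟩ := WfDvdMonoid.exists_irreducible_factor hunit hne
  refine ⟨p, hp.prime, hdvd, fun h => hp.not_isUnit (hsq p (sq p ▸ h)), fun h => ?_⟩
  rcases hp.prime.dvd_or_dvd h with h | h
  · exact hp.not_isUnit (isUnit_of_dvd_unit h (Polynomial.isUnit_C.2 hc.isUnit))
  · exact hp.not_isUnit (isUnit_of_dvd_one ((dvd_add_right (dvd_pow h hn₀)).1 hdvd))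

end Helpers

/-- The ideal `(X ^ n + Y ^ n + 1, Z ^ 3 - c X Y)` is prime when `n` and `c` are nonzero in `K`. -/
theorem isPrime_span_fermat_kummer {K : Type*} [Field K] {n : ℕ} (hn : (n : K) ≠ 0)
    {c : K} (hc : c ≠ 0) :
    (Ideal.span ({(X 0) ^ n + (X 1) ^ n + 1, (X 2) ^ 3 - C c * X 0 * X 1} :
      Set (MvPolynomial (Fin 3) K))).IsPrime := by
  have hn₀ : n ≠ 0 := by
    rintro rfl
    simp at hn
  obtain ⟨p, hp, h₁, h₂, hb⟩ := exists_prime_dvd_X_pow_add_one hn hc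
  have hJ := isPrime_span_X_pow_add_C_X_pow_sub_C hp h₁ h₂ hb hn₀ Nat.prime_three
  set J : Ideal (Polynomial (Polynomial (Polynomial K))) := Ideal.span _ with hJdef
  let φ : MvPolynomial (Fin 3) K →ₐ[K] Polynomial (Polynomial (Polynomial K)) :=
    aeval (![Polynomial.C (Polynomial.C Polynomial.X), Polynomial.C Polynomial.X, Polynomial.X] :
      Fin 3 → Polynomial (Polynomial (Polynomial K)))
  let ψ : Polynomial (Polynomial (Polynomial K)) →+* MvPolynomial (Fin 3) K :=
    Polynomial.eval₂RingHom (Polynomial.eval₂RingHom (Polynomial.eval₂RingHom C (X 0)) (X 1)) (X 2)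
  have hψφ : ψ.comp (φ : MvPolynomial (Fin 3) K →+* _) = RingHom.id _ := by
    ext i
    · simp [φ, ψ, Polynomial.algebraMap_apply]
    · fin_cases i <;> simp [φ, ψ]
  have hψ₀ : ψ (Polynomial.C (Polynomial.C Polynomial.X)) = X 0 := by simp [ψ]
  have hψ₁ : ψ (Polynomial.C Polynomial.X) = X 1 := by simp [ψ]
  have hmap : J.map ψ = Ideal.span {(X 0) ^ n + (X 1) ^ n + 1, (X 2) ^ 3 - C c * X 0 * X 1} := by
    rw [hJdef, Ideal.map_span, Set.image_pair]
    congr 2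
    · simp only [map_add, map_pow, map_one, hψ₀, hψ₁]
      ring
    · simp [ψ]
  have hcomap : J.comap φ =
      Ideal.span {(X 0) ^ n + (X 1) ^ n + 1, (X 2) ^ 3 - C c * X 0 * X 1} := by
    apply le_antisymm
    · intro x hx
      rw [← hmap, ← RingHom.id_apply x, ← hψφ]
      exact Ideal.mem_map_of_mem ψ hx
    · rw [Ideal.span_le]
      rintro x (rfl | rfl)
      · refine Ideal.subset_span (Or.inl ?_)
        simp [φ]
        ring
      · refine Ideal.subset_span (Or.inr ?_)
        simp [φ, Polynomial.algebraMap_apply, mul_assoc]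
  rw [← hcomap]
  exact Ideal.IsPrime.comap φ

/-- The ideal of `K[X,Y,Z]` generated by `X^m + Y^m + 1` and `Z³ - wXY` is
prime, where `m = (q+1)/3`, `w^m = 3`, and `K` has `q^2` elements with
`q ≡ 2 (mod 3)` a prime power. -/
theorem stmt_14 (q : ℕ) (hq : IsPrimePow q) (hq3 : q % 3 = 2)
    (K : Type*) [Field K] [Fintype K] (hK : Fintype.card K = q ^ 2)
    (m : ℕ) (hm : m = (q + 1) / 3) (w : K) (hw : w ^ m = 3) :
    (Ideal.span
        ({(X 0) ^ m + (X 1) ^ m + 1,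
          (X 2) ^ 3 - C w * X 0 * X 1} :
          Set (MvPolynomial (Fin 3) K))).IsPrime := by
  have hq₀ : (q : K) = 0 := by
    have h : ((q ^ 2 : ℕ) : K) = 0 := hK ▸ Nat.cast_card_eq_zero K
    rw [Nat.cast_pow] at h
    exact eq_zero_of_pow_eq_zero h
  have h3m : (3 : K) * m = 1 := by
    have h : 3 * m = q + 1 := by omega
    have h' : ((3 * m : ℕ) : K) = ((q + 1 : ℕ) : K) := congrArg _ h
    simpa [hq₀] using h'
  have hm₀ : m ≠ 0 := by omega
  refine isPrime_span_fermat_kummer (right_ne_zero_of_mul_eq_one h3m) ?_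
  rintro rfl
  rw [zero_pow hm₀] at hw
  exact left_ne_zero_of_mul_eq_one h3m hw.symm
end

section
/- Let K be a finite field with exactly 49 elements and let K(T) be the field of rational functions over K. Then the polynomial Z^16 − T·(T+1)^6 is irreducible in K(T)[Z] (equivalently, Z^16 − T(T+1)^6 is irreducible in K[T, Z]). (This is the statement that z^16 = t(t+1)^6 defines a degree-16 Kummer extension F = K(t, z) of the rational function field K(t); F is an F_49-maximal function field of genus 7.) -/
open Polynomial in
/-- Eisenstein's criterion for `X ^ n - a`, where the prime `p` divides `a` exactly once. -/
theorem Polynomial.irreducible_X_pow_sub_C_of_dvd_of_not_sq_dvd {R : Type*} [CommRing R]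
    [IsDomain R] {n : ℕ} (hn : n ≠ 0) {p a : R} (hp : Prime p) (hpa : p ∣ a)
    (hpa2 : ¬ p ^ 2 ∣ a) : Irreducible (X ^ n - C a) := by
  have hprime : (Ideal.span {p}).IsPrime := (Ideal.span_singleton_prime hp.ne_zero).2 hp
  have hmonic : (X ^ n - C a).Monic := monic_X_pow_sub_C a hn
  have hdeg : (X ^ n - C a).natDegree = n := natDegree_X_pow_sub_C
  refine (hmonic.isEisensteinAt_of_mem_of_notMem hprime.ne_top (fun {m} hm => ?_) ?_).irreducible
    hprime hmonic.isPrimitive (by omega)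
  · rw [hdeg] at hm
    rw [Ideal.mem_span_singleton, coeff_sub, coeff_X_pow, if_neg hm.ne, zero_sub, dvd_neg,
      coeff_C]
    split_ifs
    · exact hpa
    · exact dvd_zero p
  · rwa [Ideal.span_singleton_pow, Ideal.mem_span_singleton, coeff_sub, coeff_X_pow,
      if_neg hn.symm, zero_sub, dvd_neg, coeff_C_zero]

/-- Over `K = F_49`, the polynomial `Z^16 - T(T+1)^6` is irreducible in
`K(T)[Z]`. -/
theorem stmt_15 (K : Type*) [Field K] [Fintype K] (hK : Fintype.card K = 49) :
    Irreducible
      (Polynomial.X ^ 16 -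
        Polynomial.C (RatFunc.X * (RatFunc.X + 1) ^ 6) :
        Polynomial (RatFunc K)) := by
  have h : ¬ (Polynomial.X : Polynomial K) ^ 2 ∣ Polynomial.X * (Polynomial.X + 1) ^ 6 := by
    rw [pow_two, mul_dvd_mul_iff_left Polynomial.X_ne_zero, Polynomial.X_dvd_iff,
      Polynomial.coeff_zero_eq_eval_zero]
    simp
  have hirr := Polynomial.irreducible_X_pow_sub_C_of_dvd_of_not_sq_dvd (n := 16) (by norm_num)
    Polynomial.prime_X (dvd_mul_right _ _) h
  rw [(Polynomial.monic_X_pow_sub_C _ (by norm_num)).irreducible_iff_irreducible_map_fraction_map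
    (K := RatFunc K)] at hirr
  simpa [RatFunc.algebraMap_X] using hirr
end

section
/- Let q be a prime power and let K be a finite field with exactly q² elements. Then the polynomial Y^{q+1} − X^q − X is irreducible in the polynomial ring K[X, Y]. (This is the statement that the Hermitian equation y^{q+1} = x^q + x defines a function field H = K(x, y) with K algebraically closed in H.) -/
open MvPolynomial

/-- Eisenstein's criterion at a prime element `x`, applied to `Y ^ n - (x ^ q + x)`. -/
theorem irreducible_X_pow_sub_C_pow_add {A : Type*} [CommRing A] [IsDomain A] {x : A}
    (hx : Prime x) {n q : ℕ} (hn : n ≠ 0) (hq : 2 ≤ q) :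
    Irreducible (Polynomial.X ^ n - Polynomial.C (x ^ q + x) : Polynomial A) := by
  have hmonic := Polynomial.monic_X_pow_sub_C (x ^ q + x) hn
  have hdeg := Polynomial.natDegree_X_pow_sub_C (n := n) (r := x ^ q + x)
  have hdvd : x ∣ x ^ q + x := dvd_add (dvd_pow_self x (by omega)) dvd_rfl
  refine Polynomial.irreducible_of_eisenstein_criterion (P := Ideal.span {x})
    ((Ideal.span_singleton_prime hx.ne_zero).2 hx) ?_ ?_ ?_ ?_ hmonic.isPrimitive
  · rw [hmonic.leadingCoeff, Ideal.mem_span_singleton]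
    exact fun h => hx.not_isUnit (isUnit_of_dvd_one h)
  · intro k hk
    rw [Polynomial.degree_X_pow_sub_C (Nat.pos_of_ne_zero hn), Nat.cast_lt] at hk
    rw [Ideal.mem_span_singleton, Polynomial.coeff_sub, Polynomial.coeff_X_pow, if_neg hk.ne,
      zero_sub, dvd_neg, Polynomial.coeff_C]
    split_ifs
    · exact hdvd
    · exact dvd_zero x
  · rw [Polynomial.degree_X_pow_sub_C (Nat.pos_of_ne_zero hn)]
    exact_mod_cast Nat.pos_of_ne_zero hn
  · rw [Ideal.span_singleton_pow, Ideal.mem_span_singleton, Polynomial.coeff_sub,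
      Polynomial.coeff_X_pow, if_neg hn.symm, zero_sub, dvd_neg, Polynomial.coeff_C_zero,
      dvd_add_right (pow_dvd_pow x hq)]
    intro h
    have h' : x * x ∣ x * 1 := by rwa [mul_one, ← sq]
    exact hx.not_isUnit (isUnit_of_dvd_one ((mul_dvd_mul_iff_left hx.ne_zero).1 h'))

/-- The Hermitian polynomial `Y^{q+1} - X^q - X` is irreducible in `K[X, Y]`
for `K` a field with `q^2` elements, `q` a prime power. -/
theorem stmt_16 (q : ℕ) (hq : IsPrimePow q)
    (K : Type*) [Field K] [Fintype K] (hK : Fintype.card K = q ^ 2) :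
    Irreducible
      ((X 1) ^ (q + 1) - (X 0) ^ q - X 0 : MvPolynomial (Fin 2) K) := by
  let e := (renameEquiv K (Equiv.swap (0 : Fin 2) 1)).trans (finSuccEquiv K 1)
  have h0 : e (X 0) = Polynomial.C (X 0) := by
    simpa [e] using finSuccEquiv_X_succ (R := K) (j := (0 : Fin 1))
  have h1 : e (X 1) = Polynomial.X := by
    simpa [e] using finSuccEquiv_X_zero (R := K) (n := 1)
  rw [← MulEquiv.irreducible_iff e, map_sub, map_sub, map_pow, map_pow, h0, h1, sub_sub,
    ← map_pow, ← map_add]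
  exact irreducible_X_pow_sub_C_pow_add (X_prime (R := K) (i := (0 : Fin 1))) q.succ_ne_zero
    hq.one_lt
end
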